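/- Let Γ and Λ be icc countable groups and let Γ↷A and Λ↷B be transitive trace-preserving actions on abelian von Neumann algebras such that A⋊Γ and B⋊Λ are II₁ factors. Assume θ: A⋊Γ → B⋊Λ is a *-isomorphism with θ(L(Γ)) = L(Λ). Then dim(A) = dim(B), and for every atoms a ∈ At(A), b ∈ At(B) there is a unitary u ∈ L(Λ) with θ(L(Stab_Γ(a))) = u* L(Stab_Λ(b)) u. In addition, if there exists a ∈ At(A) such that Stab_Γ(a) is normal in Γ, then for every b ∈ At(B) the subgroup Stab_Λ(b) is normal in Λ, and Γ/Stab_Γ(a) ≅ Λ/Stab_Λ(b). -/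

import Mathlib

/-!
Common framework: we model tracial von Neumann algebras concretely, as von Neumann
algebras `M ⊆ B(H)` (Mathlib's `VonNeumannAlgebra H`, i.e. star-subalgebras equal to
their double commutant) equipped with a faithful tracial state, and we model the
crossed product `A ⋊ Γ` of a trace-preserving action axiomatically: `M` contains a
copy of `A` and a group `(u γ)` of unitaries normalizing `A`, such that the canonical
trace-preserving conditional expectation `E_A` kills `u γ` for `γ ≠ 1`, and such that
an element of `M` all of whose Fourier coefficients `E_A (x (u γ)*)` vanish is `0`.
Probability-measure-preserving actions `Γ ↷ (X, μ)` are modelled via the associated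
trace-preserving action on the abelian von Neumann algebra `A = L^∞(X)`.
-/

noncomputable section

open scoped Classical

namespace CD

/-- A group has infinite conjugacy classes (icc) if every nontrivial conjugacy
class is infinite. -/
def IsICC (Γ : Type) [Group Γ] : Prop :=
  ∀ γ : Γ, γ ≠ 1 → {g : Γ | ∃ h : Γ, g = h * γ * h⁻¹}.Infinite

/-- A faithful tracial state on (the elements of) a set `M ⊆ B(H)` (in applications,
a von Neumann algebra), given as a globally defined linear functional whose
axioms are imposed on `M`. -/
structure TraceOn (H : Type) [NormedAddCommGroup H] [InnerProductSpace ℂ H] [CompleteSpace H]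
    (M : Set (H →L[ℂ] H)) : Type where
  τ : (H →L[ℂ] H) →ₗ[ℂ] ℂ
  unital : τ 1 = 1
  tracial : ∀ x ∈ M, ∀ y ∈ M, τ (x * y) = τ (y * x)
  star_eq : ∀ x ∈ M, τ (star x) = starRingEnd ℂ (τ x)
  nonneg : ∀ x ∈ M, 0 ≤ (τ (star x * x)).re ∧ (τ (star x * x)).im = 0
  faithful : ∀ x ∈ M, τ (star x * x) = 0 → x = 0

variable {H : Type} [NormedAddCommGroup H] [InnerProductSpace ℂ H] [CompleteSpace H]

/-- The 2-norm `‖x‖₂ = τ(x* x)^{1/2}` associated with a trace. -/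
def TraceOn.norm2 {M : Set (H →L[ℂ] H)} (tr : TraceOn H M) (x : H →L[ℂ] H) : ℝ :=
  Real.sqrt (tr.τ (star x * x)).re

/-- The (unique) trace-preserving conditional expectation from `M` onto a
von Neumann subalgebra `N ⊆ M`. -/
structure CondExpOn (H : Type) [NormedAddCommGroup H] [InnerProductSpace ℂ H] [CompleteSpace H]
    (M N : Set (H →L[ℂ] H)) (tr : TraceOn H M) : Type where
  E : (H →L[ℂ] H) →ₗ[ℂ] (H →L[ℂ] H)
  mem : ∀ x ∈ M, E x ∈ N
  fix : ∀ x ∈ N, E x = x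
  bimod : ∀ a ∈ N, ∀ b ∈ N, ∀ x ∈ M, E (a * x * b) = a * E x * b
  star_map : ∀ x ∈ M, E (star x) = star (E x)
  trace_eq : ∀ x ∈ M, tr.τ (E x) = tr.τ x
  contractive : ∀ x ∈ M, tr.norm2 (E x) ≤ tr.norm2 x

/-- The double commutant of a subset of `B(H)`: the von Neumann algebra
generated by `S` (for `S` a star-closed unital set). -/
def vnGen (S : Set (H →L[ℂ] H)) : Set (H →L[ℂ] H) :=
  Set.centralizer (Set.centralizer S)

/-- Model of the crossed product von Neumann algebra `M = A ⋊ Γ` of a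
trace-preserving action `Γ ↷ (A, τ)`: `M` is generated by a copy of `A`
and canonical unitaries `(u γ)` implementing the action, with its canonical
conditional expectation `E_A` onto `A` (characterising the Fourier coefficients),
together with the group von Neumann algebra `L(Γ) = {u γ : γ}'' ⊆ M` and the
conditional expectation onto it. -/
structure CrossedProduct (Γ : Type) [Group Γ]
    (H : Type) [NormedAddCommGroup H] [InnerProductSpace ℂ H] [CompleteSpace H] : Type where
  M : VonNeumannAlgebra H
  A : VonNeumannAlgebra H
  A_sub : (A : Set (H →L[ℂ] H)) ⊆ (M : Set (H →L[ℂ] H))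
  tr : TraceOn H (M : Set (H →L[ℂ] H))
  u : Γ → (H →L[ℂ] H)
  u_mem : ∀ γ, u γ ∈ M
  u_one : u 1 = 1
  u_mul : ∀ γ δ, u γ * u δ = u (γ * δ)
  u_star : ∀ γ, star (u γ) = u γ⁻¹
  conj_mem : ∀ (γ : Γ), ∀ a ∈ A, u γ * a * star (u γ) ∈ A
  EA : CondExpOn H (M : Set (H →L[ℂ] H)) (A : Set (H →L[ℂ] H)) tr
  EA_u : ∀ γ : Γ, γ ≠ 1 → EA.E (u γ) = 0
  fourier_sep : ∀ x ∈ M, (∀ γ : Γ, EA.E (x * star (u γ)) = 0) → x = 0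
  Lg : VonNeumannAlgebra H
  Lg_eq : (Lg : Set (H →L[ℂ] H)) = vnGen (Set.range u)
  Lg_sub : (Lg : Set (H →L[ℂ] H)) ⊆ (M : Set (H →L[ℂ] H))
  EL : CondExpOn H (M : Set (H →L[ℂ] H)) (Lg : Set (H →L[ℂ] H)) tr

variable {Γ : Type} [Group Γ]

/-- The action `σ_γ = Ad(u γ)` of `Γ` on `B(H)`, restricting to the given
action on `A`. -/
def CrossedProduct.σ (X : CrossedProduct Γ H) (γ : Γ) (x : H →L[ℂ] H) : H →L[ℂ] H :=
  X.u γ * x * star (X.u γ)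

/-- The action is properly outer over the center of `P`; for abelian `P` this is
the usual freeness of the action. -/
def ProperlyOuterOn (X : CrossedProduct Γ H) (P : Set (H →L[ℂ] H)) : Prop :=
  ∀ γ : Γ, γ ≠ 1 → ∀ a ∈ P, (∀ b ∈ P, X.σ γ b * a = a * b) → a = 0

/-- Freeness of the action `Γ ↷ A`. -/
def IsFree (X : CrossedProduct Γ H) : Prop := ProperlyOuterOn X (X.A : Set (H →L[ℂ] H))

/-- Ergodicity of the action `Γ ↷ A`: the fixed points are the scalars. -/
def IsErgodic (X : CrossedProduct Γ H) : Prop :=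
  ∀ a ∈ X.A, (∀ γ : Γ, X.σ γ a = a) → ∃ c : ℂ, a = c • (1 : H →L[ℂ] H)

def IsAbelianSet (S : Set (H →L[ℂ] H)) : Prop := ∀ x ∈ S, ∀ y ∈ S, x * y = y * x

/-- `Q` is a `Γ`-invariant subset (in applications, subalgebra). -/
def InvariantUnder (X : CrossedProduct Γ H) (Q : Set (H →L[ℂ] H)) : Prop :=
  ∀ (γ : Γ), ∀ q ∈ Q, X.σ γ q ∈ Q

/-- The intermediate crossed product `Q ⋊ Γ ⊆ A ⋊ Γ` of a (`Γ`-invariant)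
subalgebra `Q ⊆ A`: those elements all of whose Fourier coefficients lie in `Q`. -/
def midCP (X : CrossedProduct Γ H) (Q : Set (H →L[ℂ] H)) : Set (H →L[ℂ] H) :=
  {x | x ∈ X.M ∧ ∀ γ : Γ, X.EA.E (x * star (X.u γ)) ∈ Q}

/-- The intermediate crossed product `A ⋊ K ⊆ A ⋊ Γ` of a subgroup `K ≤ Γ`:
those elements whose Fourier coefficients are supported on `K`. -/
def subgpCP (X : CrossedProduct Γ H) (K : Subgroup Γ) : Set (H →L[ℂ] H) :=
  {x | x ∈ X.M ∧ ∀ γ : Γ, γ ∉ K → X.EA.E (x * star (X.u γ)) = 0}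

/-- The quasinormalizer `QN_M(P)` of `P` inside `M`. -/
def QNset (M P : Set (H →L[ℂ] H)) : Set (H →L[ℂ] H) :=
  {x | x ∈ M ∧ ∃ (n : ℕ) (y : Fin n → (H →L[ℂ] H)), (∀ i, y i ∈ M) ∧
    (∀ p ∈ P, ∃ q : Fin n → (H →L[ℂ] H), (∀ i, q i ∈ P) ∧ p * x = ∑ i, y i * q i) ∧
    (∀ p ∈ P, ∃ q : Fin n → (H →L[ℂ] H), (∀ i, q i ∈ P) ∧ x * p = ∑ i, q i * y i)}

def IsUnitaryIn (S : Set (H →L[ℂ] H)) (x : H →L[ℂ] H) : Prop :=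
  x ∈ S ∧ star x * x = 1 ∧ x * star x = 1

def IsProjIn (S : Set (H →L[ℂ] H)) (p : H →L[ℂ] H) : Prop :=
  p ∈ S ∧ star p = p ∧ p * p = p

/-- The relative commutant `N' ∩ S`. -/
def commutantIn (N S : Set (H →L[ℂ] H)) : Set (H →L[ℂ] H) :=
  {x | x ∈ S ∧ ∀ y ∈ N, x * y = y * x}

/-- Conjugation `w ( · ) w*` applied to a set. -/
def conjSet (w : H →L[ℂ] H) (S : Set (H →L[ℂ] H)) : Set (H →L[ℂ] H) :=
  (fun y => w * y * star w) '' S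

/-- The scalars `ℂ 1 ⊆ B(H)`. -/
def scalars (H : Type) [NormedAddCommGroup H] [InnerProductSpace ℂ H] [CompleteSpace H] :
    Set (H →L[ℂ] H) :=
  Set.range (fun c : ℂ => c • (1 : H →L[ℂ] H))

/-- The extension `P₀ ⊆ P` of `Γ`-algebras is compact: there is a family `F ⊆ P`
with dense `‖·‖₂`-span in `P` such that the `Γ`-orbit of each `f ∈ F` can be
uniformly approximated by finitely many "`P₀`-finite rank modules". -/
def IsCompactExt (X : CrossedProduct Γ H) (P₀ P : Set (H →L[ℂ] H)) : Prop :=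
  ∃ F : Set (H →L[ℂ] H), F ⊆ P ∧
    (∀ p ∈ P, ∀ ε : ℝ, 0 < ε → ∃ (n : ℕ) (c : Fin n → ℂ) (f : Fin n → (H →L[ℂ] H)),
      (∀ i, f i ∈ F) ∧ X.tr.norm2 (p - ∑ i, c i • f i) ≤ ε) ∧
    (∀ f ∈ F, ∀ ε : ℝ, 0 < ε → ∃ (n : ℕ) (ξ : Fin n → (H →L[ℂ] H)) (C : ℝ),
      (∀ i, ξ i ∈ P) ∧
      ∀ γ : Γ, ∃ κ : Fin n → (H →L[ℂ] H), (∀ i, κ i ∈ P₀) ∧ (∀ i, ‖κ i‖ ≤ C) ∧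
        X.tr.norm2 (X.σ γ f - ∑ i, κ i * ξ i) ≤ ε)

/-- The action `Γ ↷ A` is compact: the extension over the scalars is compact. -/
def IsCompactAction (X : CrossedProduct Γ H) : Prop :=
  IsCompactExt X (scalars H) (X.A : Set (H →L[ℂ] H))

/-- The `Γ`-invariant subalgebra `B ⊆ A` gives a mixing extension: for
`t, z ∈ A ⊖ B` one has `‖E_B(t σ_γ(z))‖₂ → 0` as `γ → ∞`. -/
def IsMixingExt (X : CrossedProduct Γ H) (B : Set (H →L[ℂ] H))
    (EB : CondExpOn H (X.M : Set (H →L[ℂ] H)) B X.tr) : Prop :=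
  ∀ t ∈ X.A, ∀ z ∈ X.A, EB.E t = 0 → EB.E z = 0 →
    Filter.Tendsto (fun γ : Γ => X.tr.norm2 (EB.E (t * X.σ γ z))) Filter.cofinite (nhds 0)

/-- A `*`-isomorphism from (the von Neumann algebra with underlying set) `M ⊆ B(H₁)`
onto `N ⊆ B(H₂)`, given as a globally defined map with all axioms imposed on `M`. -/
structure StarIsoOn {H₁ : Type} [NormedAddCommGroup H₁] [InnerProductSpace ℂ H₁]
    [CompleteSpace H₁] {H₂ : Type} [NormedAddCommGroup H₂] [InnerProductSpace ℂ H₂]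
    [CompleteSpace H₂] (M : Set (H₁ →L[ℂ] H₁)) (N : Set (H₂ →L[ℂ] H₂)) : Type where
  Θ : (H₁ →L[ℂ] H₁) → (H₂ →L[ℂ] H₂)
  mem : ∀ x ∈ M, Θ x ∈ N
  map_one : Θ 1 = 1
  map_add : ∀ x ∈ M, ∀ y ∈ M, Θ (x + y) = Θ x + Θ y
  map_smul : ∀ (c : ℂ), ∀ x ∈ M, Θ (c • x) = c • Θ x
  map_mul : ∀ x ∈ M, ∀ y ∈ M, Θ (x * y) = Θ x * Θ y
  map_star : ∀ x ∈ M, Θ (star x) = star (Θ x)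
  inj : ∀ x ∈ M, ∀ y ∈ M, Θ x = Θ y → x = y
  surj : ∀ y ∈ N, ∃ x ∈ M, Θ x = y

/-- `r` is the (Pimsner–Popa/Jones) index of the inclusion `N ⊆ M`, witnessed by a
finite Pimsner–Popa basis `m₁, …, m_k` with `E_N (m_i m_j*) = δ_{ij} p_i`,
`x = ∑ᵢ E_N(x mᵢ*) mᵢ` for `x ∈ M`, and `r = ∑ᵢ τ(pᵢ)`. -/
def HasPPIndex {Mamb : Set (H →L[ℂ] H)} (tr : TraceOn H Mamb)
    (M N : Set (H →L[ℂ] H)) (r : ℝ) : Prop :=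
  ∃ E : (H →L[ℂ] H) →ₗ[ℂ] (H →L[ℂ] H),
    (∀ x ∈ M, E x ∈ N) ∧ (∀ x ∈ N, E x = x) ∧
    (∀ a ∈ N, ∀ b ∈ N, ∀ x ∈ M, E (a * x * b) = a * E x * b) ∧
    (∀ x ∈ M, tr.τ (E x) = tr.τ x) ∧
    ∃ (k : ℕ) (m p : Fin k → (H →L[ℂ] H)),
      (∀ i, m i ∈ M) ∧ (∀ i, p i ∈ N ∧ star (p i) = p i ∧ p i * p i = p i) ∧
      (∀ i j, E (m i * star (m j)) = if i = j then p i else 0) ∧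
      (∀ x ∈ M, x = ∑ i, E (x * star (m i)) * m i) ∧
      r = (∑ i, tr.τ (p i)).re

/-- The inclusion `N ⊆ M` has finite (Pimsner–Popa/Jones) index. -/
def FiniteIndexIn {Mamb : Set (H →L[ℂ] H)} (tr : TraceOn H Mamb)
    (M N : Set (H →L[ℂ] H)) : Prop :=
  ∃ r : ℝ, HasPPIndex tr M N r

/-- `S` (a von Neumann algebra) is a factor: trivial center. -/
def IsFactorSet (S : Set (H →L[ℂ] H)) : Prop :=
  ∀ x ∈ S, (∀ y ∈ S, x * y = y * x) → ∃ c : ℂ, x = c • (1 : H →L[ℂ] H)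

/-- `S` is a II₁ factor (with respect to the trace `tr`): a factor whose
projections realize every trace value in `[0,1]`. -/
def IsII1On {Mamb : Set (H →L[ℂ] H)} (tr : TraceOn H Mamb) (S : Set (H →L[ℂ] H)) : Prop :=
  IsFactorSet S ∧ ∀ r : ℝ, 0 ≤ r → r ≤ 1 →
    ∃ p ∈ S, star p = p ∧ p * p = p ∧ tr.τ p = (r : ℂ)

def IsFinDimSet (S : Set (H →L[ℂ] H)) : Prop :=
  ∃ (n : ℕ) (v : Fin n → (H →L[ℂ] H)), (∀ i, v i ∈ S) ∧
    ∀ x ∈ S, ∃ c : Fin n → ℂ, x = ∑ i, c i • v i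

def IsStarSubalgSet (S : Set (H →L[ℂ] H)) : Prop :=
  (1 : H →L[ℂ] H) ∈ S ∧ (∀ x ∈ S, ∀ y ∈ S, x + y ∈ S) ∧ (∀ x ∈ S, ∀ y ∈ S, x * y ∈ S) ∧
    (∀ (c : ℂ), ∀ x ∈ S, c • x ∈ S) ∧ (∀ x ∈ S, star x ∈ S)

/-- `S` is approximately finite dimensional (with respect to `‖·‖₂`); by Connes'
theorem this is equivalent to amenability for (separable, tracial) von Neumann
algebras. -/
def IsAFD {Mamb : Set (H →L[ℂ] H)} (tr : TraceOn H Mamb) (S : Set (H →L[ℂ] H)) : Prop :=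
  ∃ Q : ℕ → Set (H →L[ℂ] H), (∀ n, Q n ⊆ S) ∧ (∀ n, Q n ⊆ Q (n + 1)) ∧
    (∀ n, IsFinDimSet (Q n)) ∧ (∀ n, IsStarSubalgSet (Q n)) ∧
    ∀ x ∈ S, ∀ ε : ℝ, 0 < ε → ∃ n, ∃ y ∈ Q n, tr.norm2 (x - y) ≤ ε

/-- `S` is diffuse: it has no minimal projections. -/
def IsDiffuseSet (S : Set (H →L[ℂ] H)) : Prop :=
  ∀ p, IsProjIn S p → p ≠ 0 →
    ∃ q, IsProjIn S q ∧ q ≠ 0 ∧ q ≠ p ∧ q * p = q ∧ p * q = q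

/-- The (trace-preserving) action of `Γ` on the subalgebra `Q` is transitive:
`Q` is spanned by finitely many orthogonal minimal projections summing to `1`
which are permuted transitively by `Γ`. -/
def IsTransitiveOn (X : CrossedProduct Γ H) (Q : Set (H →L[ℂ] H)) : Prop :=
  ∃ (n : ℕ) (e : Fin n → (H →L[ℂ] H)),
    (∀ i, e i ∈ Q ∧ star (e i) = e i ∧ e i * e i = e i) ∧
    (∀ i j, i ≠ j → e i * e j = 0) ∧ (∑ i, e i = 1) ∧
    (∀ q ∈ Q, ∃ c : Fin n → ℂ, q = ∑ i, c i • e i) ∧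
    (∀ i j, ∃ γ : Γ, X.σ γ (e i) = e j)

/-- An abelian von Neumann algebra `S` is completely atomic: every nonzero
projection dominates a minimal projection. -/
def IsCompletelyAtomic (S : Set (H →L[ℂ] H)) : Prop :=
  ∀ p, IsProjIn S p → p ≠ 0 →
    ∃ q, IsProjIn S q ∧ q ≠ 0 ∧ q * p = q ∧
      ∀ r, IsProjIn S r → r * q = r → r = 0 ∨ r = q

end CD

namespace CD

/-- The group von Neumann algebra `L(Stab_Γ(a)) ⊆ A ⋊ Γ` of the stabilizer
`Stab_Γ(a) = {γ : σ_γ(a) = a}` of an element `a`. -/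
def LStabSet {Γ H : Type} [Group Γ] [NormedAddCommGroup H] [InnerProductSpace ℂ H]
    [CompleteSpace H] (X : CrossedProduct Γ H) (a : H →L[ℂ] H) : Set (H →L[ℂ] H) :=
  vnGen (X.u '' {γ : Γ | X.σ γ a = a})

end CD


namespace CD

section Ops

variable {H : Type} [NormedAddCommGroup H] [InnerProductSpace ℂ H] [CompleteSpace H]

theorem mem_of_comm (M : VonNeumannAlgebra H) {x : H →L[ℂ] H}
    (h : ∀ s ∈ M.commutant, s * x = x * s) : x ∈ M := by
  rw [← M.commutant_commutant]
  exact VonNeumannAlgebra.mem_commutant_iff.2 h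

theorem comm_of_mem (M : VonNeumannAlgebra H) {x s : H →L[ℂ] H}
    (hx : x ∈ M) (hs : s ∈ M.commutant) : s * x = x * s :=
  (VonNeumannAlgebra.mem_commutant_iff.1 hs x hx).symm

theorem smul_mem' (M : VonNeumannAlgebra H) (c : ℂ) {x : H →L[ℂ] H} (hx : x ∈ M) : c • x ∈ M := by
  apply mem_of_comm
  intro s hs
  rw [mul_smul_comm, smul_mul_assoc, comm_of_mem M hx hs]

theorem cfc_mem (M : VonNeumannAlgebra H) {a : H →L[ℂ] H} (ha : a ∈ M) (f : ℝ → ℝ) :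
    cfc f a ∈ M := by
  apply mem_of_comm
  intro s hs
  have h : Commute a s := (comm_of_mem M ha hs).symm
  exact (h.cfc_real f).symm

theorem range_proj (M : VonNeumannAlgebra H) (V : Submodule ℂ H)
    (hV : ∀ s ∈ M.commutant, ∀ ξ ∈ V, s ξ ∈ V) :
    ∃ P ∈ M, star P = P ∧ P * P = P ∧ (∀ ξ ∈ V, P ξ = ξ) ∧
      (∀ c : H →L[ℂ] H, (∀ ξ ∈ V, c ξ = 0) → c * P = 0) := by
  let K := V.topologicalClosure
  have hKc : IsClosed (K : Set H) := V.isClosed_topologicalClosure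
  have : CompleteSpace K := hKc.completeSpace_coe
  have hstar : IsStarProjection K.starProjection := isStarProjection_starProjection
  have hker : ∀ c : H →L[ℂ] H, (∀ ξ ∈ V, c ξ = 0) → ∀ ξ ∈ K, c ξ = 0 := by
    intro c hc
    have h2 : V ≤ LinearMap.ker (c : H →ₗ[ℂ] H) := fun ξ hξ => by simpa using hc ξ hξ
    have h3 : V.topologicalClosure ≤ LinearMap.ker (c : H →ₗ[ℂ] H) :=
      V.topologicalClosure_minimal h2 c.isClosed_ker
    intro ξ hξ
    simpa using h3 hξ
  refine ⟨K.starProjection, ?_, hstar.isSelfAdjoint.star_eq, hstar.isIdempotentElem, ?_, ?_⟩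
  · rw [VonNeumannAlgebra.IsStarProjection.mem_iff hstar]
    intro y hy
    rw [Module.End.mem_invtSubmodule]
    have hr : (K.starProjection : H →ₗ[ℂ] H).range = K := K.range_starProjection
    rw [hr]
    intro ξ hξ
    have : K ≤ Submodule.comap (y : H →ₗ[ℂ] H) K := by
      refine V.topologicalClosure_minimal ?_ ?_
      · intro η hη
        exact V.le_topologicalClosure (hV y hy η hη)
      · exact hKc.preimage y.continuous
    exact this hξ
  · intro ξ hξ
    exact Submodule.starProjection_eq_self_iff.2 (V.le_topologicalClosure hξ)
  · intro c hc
    ext ξ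
    exact hker c hc _ (K.starProjection_apply_mem ξ)

theorem range_proj_op (M : VonNeumannAlgebra H) {d : H →L[ℂ] H} (hd : d ∈ M) :
    ∃ P ∈ M, star P = P ∧ P * P = P ∧ P * d = d ∧
      (∀ c : H →L[ℂ] H, c * d = 0 → c * P = 0) := by
  obtain ⟨P, hP, h1, h2, h3, h4⟩ := range_proj M (LinearMap.range (d : H →ₗ[ℂ] H)) (by
    rintro s hs _ ⟨η, rfl⟩
    refine ⟨s η, ?_⟩
    have := congrArg (fun T : H →L[ℂ] H => T η) (comm_of_mem M hd hs)
    simpa using this.symm)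
  refine ⟨P, hP, h1, h2, ?_, ?_⟩
  · ext ξ
    exact h3 (d ξ) ⟨ξ, rfl⟩
  · intro c hc
    apply h4
    rintro _ ⟨η, rfl⟩
    have := congrArg (fun T : H →L[ℂ] H => T η) hc
    simpa using this

theorem exists_cut (M : VonNeumannAlgebra H) {c : H →L[ℂ] H} (hcM : c ∈ M) (hc : 0 ≤ c)
    (hne : c ≠ 0) :
    ∃ e ∈ M, ∃ k ∈ M, e ≠ 0 ∧ star e = e ∧ e * e = e ∧ star k = k ∧ c * k = k * c ∧
      c * k * k * e = e ∧ ∀ y : H →L[ℂ] H, y * c = c → y * e = e := by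
  have hsa : IsSelfAdjoint c := IsSelfAdjoint.of_nonneg hc
  have : Nontrivial (H →L[ℂ] H) := ⟨⟨c, 0, hne⟩⟩
  set ε : ℝ := ‖c‖ / 2 with hε
  have hnpos : 0 < ‖c‖ := norm_pos_iff.2 hne
  have hεpos : 0 < ε := by positivity
  have hmaxpos : ∀ t : ℝ, 0 < max t ε := fun t => lt_max_of_lt_right hεpos
  let κ : ℝ → ℝ := fun t => 1 / Real.sqrt (max t ε)
  let f : ℝ → ℝ := fun t => max (t - ε) 0
  let f2 : ℝ → ℝ := fun t => max (t - ε) 0 / max t ε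
  have hκc : Continuous κ := by
    refine Continuous.div continuous_const (by fun_prop) ?_
    intro t
    exact (Real.sqrt_pos.2 (hmaxpos t)).ne'
  have hfc : Continuous f := by fun_prop
  have hf2c : Continuous f2 := Continuous.div (by fun_prop) (by fun_prop) (fun t => (hmaxpos t).ne')
  have hid : cfc (fun t : ℝ => t) c = c := cfc_id' ℝ c
  have e1 : c * cfc κ c * cfc κ c * cfc f c = cfc f c := by
    conv_lhs => rw [← hid]
    rw [cfc_id' ℝ c]
    nth_rewrite 1 [← hid]
    rw [← cfc_mul (fun t : ℝ => t) κ c (by fun_prop) hκc.continuousOn,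
      ← cfc_mul _ κ c (by fun_prop) hκc.continuousOn,
      ← cfc_mul _ f c (by fun_prop) hfc.continuousOn]
    congr 1
    ext t
    simp only [κ, f]
    rcases le_total t ε with h | h
    · rw [max_eq_right (a := t - ε) (b := 0) (by linarith)]; simp
    · rw [max_eq_left h]
      have ht : 0 < t := by linarith
      have : t * (1 / √t) * (1 / √t) = 1 := by
        have h2 : √t ≠ 0 := (Real.sqrt_pos.2 ht).ne'
        field_simp
        rw [Real.sq_sqrt ht.le]
      rw [this, one_mul]
  have e2 : c * cfc f2 c = cfc f c := by
    nth_rewrite 1 [← hid]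
    rw [← cfc_mul (fun t : ℝ => t) f2 c (by fun_prop) hf2c.continuousOn]
    congr 1
    ext t
    simp only [f2, f]
    rcases le_total t ε with h | h
    · rw [max_eq_right (a := t - ε) (b := 0) (by linarith)]; simp
    · rw [max_eq_left h]
      have ht : 0 < t := by linarith
      field_simp
  have hd0 : cfc f c ≠ 0 := by
    intro h0
    have h1 : ‖c‖ ∈ spectrum ℝ c := CStarAlgebra.norm_mem_spectrum_of_nonneg hc
    have h2 : f ‖c‖ ∈ spectrum ℝ (cfc f c) := by
      rw [cfc_map_spectrum f c hsa hfc.continuousOn]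
      exact ⟨_, h1, rfl⟩
    rw [h0, spectrum.zero_eq] at h2
    have h3 : f ‖c‖ = 0 := h2
    simp only [f, hε] at h3
    have := le_max_left (‖c‖ - ‖c‖ / 2) 0
    linarith
  obtain ⟨P, hP, p1, p2, p3, p4⟩ := range_proj_op M (cfc_mem M hcM f)
  refine ⟨P, hP, cfc κ c, cfc_mem M hcM κ, ?_, p1, p2, ?_, ?_, ?_, ?_⟩
  · rintro rfl
    exact hd0 (by rw [← p3, zero_mul])
  · exact (cfc_predicate κ c : IsSelfAdjoint _).star_eq
  · exact ((Commute.refl c).cfc_real κ).symm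
  · have := p4 (c * cfc κ c * cfc κ c - 1) (by rw [sub_mul, e1, one_mul, sub_self])
    rw [sub_mul, one_mul, sub_eq_zero] at this
    exact this
  · intro y hy
    have := p4 (y - 1) (by rw [sub_mul, ← e2, ← mul_assoc, hy, one_mul, sub_self])
    rw [sub_mul, one_mul, sub_eq_zero] at this
    exact this

open Filter Topology in
theorem exists_lim {ι : Type} [Preorder ι] [IsDirectedOrder ι] [Nonempty ι]
    (w : ι → (H →L[ℂ] H)) (hb : ∀ i, ‖w i‖ ≤ 1) (φ : H → ι → ℝ)
    (hφ : ∀ ξ, BddAbove (Set.range (φ ξ)))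
    (h : ∀ ξ i j, i ≤ j → ‖w j ξ - w i ξ‖ ^ 2 ≤ φ ξ j - φ ξ i) :
    ∃ v : H →L[ℂ] H, ∀ ξ, Tendsto (fun i => w i ξ) atTop (𝓝 (v ξ)) := by
  have hlim : ∀ ξ, ∃ η, Tendsto (fun i => w i ξ) atTop (𝓝 η) := by
    intro ξ
    apply CompleteSpace.complete
    rw [Metric.cauchy_iff]
    refine ⟨inferInstance, ?_⟩
    intro ε hε
    obtain ⟨i0, hi0⟩ := exists_lt_of_lt_ciSup (f := φ ξ)
      (b := (⨆ i, φ ξ i) - (ε / 2) ^ 2) (by have : 0 < (ε / 2) ^ 2 := by positivity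
                                            linarith)
    refine ⟨(fun i => w i ξ) '' Set.Ici i0, image_mem_map (Ici_mem_atTop i0), ?_⟩
    have key : ∀ i, i0 ≤ i → dist (w i ξ) (w i0 ξ) < ε / 2 := by
      intro i hi
      rw [dist_eq_norm]
      have h1 := h ξ i0 i hi
      have h2 := le_ciSup (hφ ξ) i
      have : ‖w i ξ - w i0 ξ‖ ^ 2 < (ε / 2) ^ 2 := by linarith
      exact lt_of_pow_lt_pow_left₀ 2 (by positivity) this
    rintro _ ⟨i, hi, rfl⟩ _ ⟨j, hj, rfl⟩
    have h1 := key i hi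
    have h2 := key j hj
    rw [dist_comm] at h2
    calc dist (w i ξ) (w j ξ) ≤ dist (w i ξ) (w i0 ξ) + dist (w i0 ξ) (w j ξ) := dist_triangle _ _ _
      _ < ε := by linarith
  choose g hg using hlim
  let L : H →ₗ[ℂ] H :=
    { toFun := g
      map_add' := fun x y => tendsto_nhds_unique (hg (x + y)) (by
        simpa using (hg x).add (hg y))
      map_smul' := fun c x => tendsto_nhds_unique (hg (c • x)) (by
        simpa using (hg x).const_smul c) }
  refine ⟨L.mkContinuous 1 ?_, fun ξ => hg ξ⟩
  intro ξ
  refine le_of_tendsto (hg ξ).norm (Eventually.of_forall fun i => ?_)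
  exact (w i).le_of_opNorm_le (hb i) ξ

end Ops

end CD

namespace CD

section Cmp

variable {H : Type} [NormedAddCommGroup H] [InnerProductSpace ℂ H] [CompleteSpace H]

theorem exists_piso (M : VonNeumannAlgebra H) {x : H →L[ℂ] H} (hx : x ∈ M) (hne : x ≠ 0) :
    ∃ w ∈ M, w ≠ 0 ∧ w * star w * w = w ∧ (∀ y, y * x = x → y * w = w) ∧
      (∀ q, star q = q → x * q = x → w * q = w) := by
  have hc0 : star x * x ≠ 0 := by
    intro h
    exact hne ((CStarRing.star_mul_self_eq_zero_iff x).1 h)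
  obtain ⟨e, he, k, hk, e0, es, ee, ks, kc, cke, hy⟩ :=
    exists_cut M (c := star x * x) (mul_mem (star_mem hx) hx) (star_mul_self_nonneg x) hc0
  have hww : star (x * k * e) * (x * k * e) = e := by
    rw [star_mul, star_mul, es, ks]
    calc e * (k * star x) * (x * k * e) = e * ((k * (star x * x)) * k * e) := by noncomm_ring
      _ = e * (star x * x * k * k * e) := by rw [← kc]
      _ = e := by rw [cke, ee]
  refine ⟨x * k * e, mul_mem (mul_mem hx hk) he, ?_, ?_, ?_, ?_⟩
  · intro h
    rw [h, mul_zero] at hww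
    exact e0 hww.symm
  · rw [mul_assoc (x * k * e), hww, mul_assoc, ee]
  · intro y hyx
    rw [← mul_assoc, ← mul_assoc, hyx]
  · intro q hq hxq
    have h1 : q * e = e := hy q (by
      rw [← mul_assoc]
      congr 1
      have := congrArg star hxq
      rwa [star_mul, hq] at this)
    have h2 : e * q = e := by
      have := congrArg star h1
      rwa [star_mul, hq, es] at this
    rw [mul_assoc, h2]

theorem factor_zero (M : VonNeumannAlgebra H) (hf : IsFactorSet (M : Set (H →L[ℂ] H)))
    {p q : H →L[ℂ] H} (hq : q ∈ M) (h : ∀ y ∈ M, p * y * q = 0) : p = 0 ∨ q = 0 := by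
  let S : Set H := {ζ | ∃ y ∈ M, ∃ ξ, ζ = y (q ξ)}
  have hinv : ∀ s : H →L[ℂ] H, (∀ ζ ∈ S, s ζ ∈ S) →
      ∀ ζ ∈ Submodule.span ℂ S, s ζ ∈ Submodule.span ℂ S := by
    intro s hs
    have : Submodule.span ℂ S ≤ (Submodule.span ℂ S).comap (s : H →ₗ[ℂ] H) := by
      rw [Submodule.span_le]
      intro ζ hζ
      exact Submodule.subset_span (hs ζ hζ)
    exact this
  have hker : ∀ s : H →L[ℂ] H, (∀ ζ ∈ S, s ζ = 0) → ∀ ζ ∈ Submodule.span ℂ S, s ζ = 0 := by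
    intro s hs
    have : Submodule.span ℂ S ≤ LinearMap.ker (s : H →ₗ[ℂ] H) := by
      rw [Submodule.span_le]
      intro ζ hζ
      simpa using hs ζ hζ
    intro ζ hζ
    simpa using this hζ
  obtain ⟨P, hP, p1, p2, p3, p4⟩ := range_proj M (Submodule.span ℂ S) (by
    intro s hs
    apply hinv
    rintro _ ⟨y, hy, ξ, rfl⟩
    refine ⟨y, hy, s ξ, ?_⟩
    have := congrArg (fun T : H →L[ℂ] H => T ξ) (comm_of_mem M (mul_mem hy hq) hs)
    simpa using this)
  have hMinv : ∀ y ∈ M, ∀ ζ ∈ Submodule.span ℂ S, y ζ ∈ Submodule.span ℂ S := by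
    intro y hy
    apply hinv
    rintro _ ⟨y', hy', ξ, rfl⟩
    exact ⟨y * y', mul_mem hy hy', ξ, rfl⟩
  have c1 : ∀ y ∈ M, y * P = P * y * P := by
    intro y hy
    have := p4 ((1 - P) * y) (by
      intro ζ hζ
      have := p3 _ (hMinv y hy ζ hζ)
      simp [this])
    have h2 : y * P - P * y * P = 0 := by rw [← this]; noncomm_ring
    exact sub_eq_zero.1 h2
  have c2 : ∀ y ∈ M, P * y = y * P := by
    intro y hy
    have h1 := congrArg star (c1 (star y) (star_mem hy))
    simp only [star_mul, star_star, p1] at h1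
    exact h1.trans ((mul_assoc _ _ _).symm.trans (c1 y hy).symm)
  obtain ⟨c, hc⟩ := hf P hP c2
  have hPq : P * q = q := by
    ext ξ
    exact p3 _ (Submodule.subset_span ⟨1, one_mem M, ξ, rfl⟩)
  have hpP : p * P = 0 := by
    apply p4
    apply hker
    rintro _ ⟨y, hy, ξ, rfl⟩
    have := congrArg (fun T : H →L[ℂ] H => T ξ) (h y hy)
    simpa using this
  by_cases hc0 : c = 0
  · right
    rw [← hPq, hc, hc0, zero_smul, zero_mul]
  · left
    rw [hc, mul_smul_comm, mul_one] at hpP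
    exact (smul_eq_zero.1 hpP).resolve_left hc0

theorem piso_le {v v' : H →L[ℂ] H} (hv : v * star v * v = v) (hv' : v' * star v' * v' = v')
    (h : v' * (star v * v) = v) : star v' * v = star v * v := by
  have h1 : star v * v * (star v' * v') * (star v * v) = star v * v := by
    calc star v * v * (star v' * v') * (star v * v)
        = star (v' * (star v * v)) * (v' * (star v * v)) := by
          simp only [star_mul, star_star]; noncomm_ring
      _ = star v * v := by rw [h]
  have he : star v * v * (star v * v) = star v * v := by
    rw [mul_assoc, ← mul_assoc v, hv]
  have he' : star v' * v' * (star v' * v') = star v' * v' := by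
    rw [mul_assoc, ← mul_assoc v', hv']
  have hs : star (star v * v) = star v * v := by simp
  have hs' : star (star v' * v') = star v' * v' := by simp
  generalize hE : star v * v = e at *
  generalize hE' : star v' * v' = e' at *
  have h2 : star ((1 - e') * e) * ((1 - e') * e) = 0 := by
    rw [star_mul, star_sub, star_one, hs, hs']
    calc e * (1 - e') * ((1 - e') * e) = e * e - e * e' * e - e * e' * e + e * (e' * e') * e := by
          noncomm_ring
      _ = 0 := by rw [he', he, h1]; simp
  have h3 := (CStarRing.star_mul_self_eq_zero_iff _).1 h2
  rw [sub_mul, one_mul, sub_eq_zero] at h3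
  calc star v' * v = star v' * (v' * e) := by rw [h]
    _ = e' * e := by rw [← mul_assoc, hE']
    _ = e := h3.symm

theorem piso_norm {v : H →L[ℂ] H} (hv : v * star v * v = v) : ‖v‖ ≤ 1 := by
  have h1 : ‖star v * v‖ = ‖v‖ * ‖v‖ := CStarRing.norm_star_mul_self
  have h2 : ‖v‖ ≤ ‖v‖ * (‖v‖ * ‖v‖) := by
    calc ‖v‖ = ‖v * (star v * v)‖ := by rw [← mul_assoc, hv]
      _ ≤ ‖v‖ * ‖star v * v‖ := norm_mul_le _ _
      _ = _ := by rw [h1]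
  by_contra hcon
  push Not at hcon
  have hadj : ‖star v * v‖ * ‖star v * v‖ = ‖star v * v‖ := by
    have h3 : star (star v * v) * (star v * v) = star v * v := by
      simp only [star_mul, star_star]
      rw [mul_assoc, ← mul_assoc v, hv]
    have h4 : ‖star (star v * v) * (star v * v)‖ = ‖star v * v‖ * ‖star v * v‖ :=
      CStarRing.norm_star_mul_self
    rw [← h4, h3]
  rw [h1] at hadj
  nlinarith [mul_pos (by linarith : (0:ℝ) < ‖v‖) (by linarith : (0:ℝ) < ‖v‖)]

open Filter Topology in
theorem piso_lim {ι : Type} [Preorder ι] [IsDirectedOrder ι] [Nonempty ι]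
    (w : ι → (H →L[ℂ] H)) (hw : ∀ i, w i * star (w i) * w i = w i)
    (hle : ∀ i j, i ≤ j → w j * (star (w i) * w i) = w i) :
    ∃ v : H →L[ℂ] H, (∀ ξ, Tendsto (fun i => w i ξ) atTop (𝓝 (v ξ))) ∧ v * star v * v = v ∧
      ∀ i, v * (star (w i) * w i) = w i := by
  have hstar : ∀ i j, i ≤ j → star (w i) * w j = star (w i) * w i := by
    intro i j hij
    have := congrArg star (piso_le (hw i) (hw j) (hle i j hij))
    simpa using this
  obtain ⟨v, hv⟩ := exists_lim w (fun i => piso_norm (hw i)) (fun ξ i => ‖w i ξ‖ ^ 2) (by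
    intro ξ
    refine ⟨‖ξ‖ ^ 2, ?_⟩
    rintro _ ⟨i, rfl⟩
    have := (w i).le_of_opNorm_le (piso_norm (hw i)) ξ
    simp only
    gcongr
    simpa using this) (by
    intro ξ i j hij
    have h1 : inner ℂ (w j ξ) (w i ξ) = inner ℂ (w i ξ) (w i ξ) := by
      have e1 : inner ℂ (w j ξ) (w i ξ) = inner ℂ ((star (w i) * w j) ξ) ξ := by
        rw [ContinuousLinearMap.star_eq_adjoint]
        simp [ContinuousLinearMap.adjoint_inner_left]
      have e2 : inner ℂ (w i ξ) (w i ξ) = inner ℂ ((star (w i) * w i) ξ) ξ := by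
        rw [ContinuousLinearMap.star_eq_adjoint]
        simp [ContinuousLinearMap.adjoint_inner_left]
      rw [e1, e2, hstar i j hij]
    rw [@norm_sub_sq ℂ, h1, inner_self_eq_norm_sq]
    linarith)
  have hvi : ∀ i, v * (star (w i) * w i) = w i := by
    intro i
    ext ξ
    refine tendsto_nhds_unique (hv ((star (w i) * w i) ξ)) ?_
    refine Tendsto.congr' ?_ tendsto_const_nhds
    filter_upwards [Ici_mem_atTop i] with j hj
    exact (congrArg (fun T : H →L[ℂ] H => T ξ) (hle i j hj)).symm
  have hvs : ∀ i, star (w i) * v = star (w i) * w i := by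
    intro i
    ext ξ
    refine tendsto_nhds_unique (((star (w i)).continuous.tendsto _).comp (hv ξ)) ?_
    refine Tendsto.congr' ?_ tendsto_const_nhds
    filter_upwards [Ici_mem_atTop i] with j hj
    exact (congrArg (fun T : H →L[ℂ] H => T ξ) (hstar i j hj)).symm
  refine ⟨v, hv, ?_, hvi⟩
  have h1 : ∀ i, v * star v * w i = w i := by
    intro i
    have := congrArg star (hvs i)
    simp only [star_mul, star_star] at this
    rw [mul_assoc, this, hvi]
  ext ξ
  refine tendsto_nhds_unique (((v * star v).continuous.tendsto _).comp (hv ξ)) ?_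
  refine Tendsto.congr ?_ (hv ξ)
  intro i
  exact (congrArg (fun T : H →L[ℂ] H => T ξ) (h1 i)).symm

open Filter Topology in
theorem lim_mem (M : VonNeumannAlgebra H) {ι : Type} [Preorder ι] [IsDirectedOrder ι] [Nonempty ι]
    (w : ι → (H →L[ℂ] H)) (hw : ∀ i, w i ∈ M) (v : H →L[ℂ] H)
    (hv : ∀ ξ, Tendsto (fun i => w i ξ) atTop (𝓝 (v ξ))) : v ∈ M := by
  apply mem_of_comm
  intro s hs
  ext ξ
  refine tendsto_nhds_unique ((s.continuous.tendsto _).comp (hv ξ)) ?_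
  refine Tendsto.congr ?_ (hv (s ξ))
  intro i
  exact (congrArg (fun T : H →L[ℂ] H => T ξ) (comm_of_mem M (hw i) hs)).symm

open Filter Topology in
theorem lim_left {ι : Type} [Preorder ι] [IsDirectedOrder ι] [Nonempty ι]
    (w : ι → (H →L[ℂ] H)) (v p q : H →L[ℂ] H) (hw : ∀ i, p * w i * q = w i)
    (hv : ∀ ξ, Tendsto (fun i => w i ξ) atTop (𝓝 (v ξ))) : p * v * q = v := by
  ext ξ
  refine tendsto_nhds_unique ((p.continuous.tendsto _).comp (hv (q ξ))) ?_
  refine Tendsto.congr ?_ (hv ξ)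
  intro i
  exact (congrArg (fun T : H →L[ℂ] H => T ξ) (hw i)).symm

theorem chain_dir {α : Type} (r : α → α → Prop) (hr : ∀ a, r a a)
    (ht : ∀ a b c, r a b → r b c → r a c) (c : Set α) (hc : IsChain r c) (hne : c.Nonempty) :
    ∃ (ι : Type) (_ : Preorder ι) (_ : IsDirectedOrder ι) (_ : Nonempty ι) (f : ι → α),
      (∀ i, f i ∈ c) ∧ (∀ a ∈ c, ∃ i, f i = a) ∧ ∀ i j, i ≤ j → r (f i) (f j) := by
  let P : Preorder c :=
    { le := fun a b => r a.1 b.1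
      le_refl := fun a => hr _
      le_trans := fun a b d h1 h2 => ht _ _ _ h1 h2 }
  refine ⟨c, P, ⟨fun a b => ?_⟩, hne.to_subtype, Subtype.val, fun i => i.2,
    fun a ha => ⟨⟨a, ha⟩, rfl⟩, fun i j h => h⟩
  by_cases hab : a = b
  · exact ⟨a, hr _, by rw [hab]⟩
  · rcases hc a.2 b.2 (fun h => hab (Subtype.ext h)) with h | h
    · exact ⟨b, h, hr _⟩
    · exact ⟨a, hr _, h⟩

theorem comparison (M : VonNeumannAlgebra H) (hf : IsFactorSet (M : Set (H →L[ℂ] H)))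
    {p q : H →L[ℂ] H} (hp : p ∈ M) (hps : star p = p) (hpp : p * p = p)
    (hq : q ∈ M) (hqs : star q = q) (hqq : q * q = q) :
    ∃ v ∈ M, v * star v * v = v ∧ p * v = v ∧ v * q = v ∧ (v * star v = p ∨ star v * v = q) := by
  let α := {v : H →L[ℂ] H // v ∈ M ∧ v * star v * v = v ∧ p * v = v ∧ v * q = v}
  let r : α → α → Prop := fun v v' => v'.1 * (star v.1 * v.1) = v.1
  have htrans : ∀ {a b c : α}, r a b → r b c → r a c := by
    intro a b c hab hbc
    have h1 := piso_le a.2.2.1 b.2.2.1 hab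
    have hbc' : c.1 * (star b.1 * b.1) = b.1 := hbc
    have hab' : b.1 * (star a.1 * a.1) = a.1 := hab
    change c.1 * (star a.1 * a.1) = a.1
    have h2 : star b.1 * b.1 * (star a.1 * a.1) = star a.1 * a.1 := by
      rw [mul_assoc, hab', h1]
    rw [← h2, ← mul_assoc, hbc', hab']
  obtain ⟨m, hm⟩ := exists_maximal_of_chains_bounded (r := r) (by
    intro c hc
    rcases c.eq_empty_or_nonempty with rfl | hne
    · exact ⟨⟨0, zero_mem M, by simp, by simp, by simp⟩, by simp⟩
    · obtain ⟨ι, _, _, _, f, hfc, hcf, hmono⟩ := chain_dir r (fun a => by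
        change a.1 * (star a.1 * a.1) = a.1
        rw [← mul_assoc]; exact a.2.2.1) (fun a b c => htrans) c hc hne
      obtain ⟨v, hv, hv1, hv2⟩ := piso_lim (fun i : ι => (f i).1) (fun i => (f i).2.2.1)
        (fun i j hij => hmono i j hij)
      refine ⟨⟨v, lim_mem M _ (fun i : ι => (f i).2.1) v hv, hv1, ?_, ?_⟩, ?_⟩
      · have := lim_left (fun i : ι => (f i).1) v p 1
          (fun i => by rw [mul_one]; exact (f i).2.2.2.1) hv
        simpa using this
      · have := lim_left (fun i : ι => (f i).1) v 1 q
          (fun i => by rw [one_mul]; exact (f i).2.2.2.2) hv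
        simpa using this
      · intro a ha
        obtain ⟨i, rfl⟩ := hcf a ha
        exact hv2 i) htrans
  obtain ⟨v, hvM, hvv, hpv, hvq⟩ := m
  refine ⟨v, hvM, hvv, hpv, hvq, ?_⟩
  have hsv : star v * v * star v = star v := by
    have := congrArg star hvv
    simpa [mul_assoc] using this
  have hzero : ∀ y ∈ M, (p - v * star v) * y * (q - star v * v) = 0 := by
    intro y hy
    by_contra hne
    obtain ⟨w, hwM, hw0, hww, hwl, hwr⟩ := exists_piso M
      (mul_mem (mul_mem (sub_mem hp (mul_mem hvM (star_mem hvM))) hy)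
        (sub_mem hq (mul_mem (star_mem hvM) hvM))) hne
    have hvp : star v * p = star v := by
      have := congrArg star hpv
      rwa [star_mul, hps] at this
    have hqv : q * star v = star v := by
      have := congrArg star hvq
      rwa [star_mul, hqs] at this
    have a1 : v * star v * w = 0 := by
      have := hwl (1 - v * star v) (by
        have : (1 - v * star v) * (p - v * star v) = p - v * star v := by
          calc (1 - v * star v) * (p - v * star v)
              = p - v * star v - v * (star v * p) + (v * star v * v) * star v := by noncomm_ring
            _ = _ := by rw [hvp, hvv]; abel
        rw [← mul_assoc, ← mul_assoc, this])
      rw [sub_mul, one_mul] at this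
      exact sub_eq_self.1 this
    have a2 : w * (star v * v) = 0 := by
      have := hwr (1 - star v * v) (by simp) (by
        have : (q - star v * v) * (1 - star v * v) = q - star v * v := by
          calc (q - star v * v) * (1 - star v * v)
              = q - star v * v - (q * star v) * v + (star v * v * star v) * v := by noncomm_ring
            _ = _ := by rw [hqv, hsv]; abel
        rw [mul_assoc, this])
      rw [mul_sub, mul_one] at this
      exact sub_eq_self.1 this
    have a3 : p * w = w := hwl p (by
      have : p * (p - v * star v) = p - v * star v := by
        rw [mul_sub, hpp, ← mul_assoc, hpv]
      rw [← mul_assoc, ← mul_assoc, this])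
    have a4 : w * q = w := hwr q hqs (by
      have : (q - star v * v) * q = q - star v * v := by
        rw [sub_mul, hqq, mul_assoc, hvq]
      rw [mul_assoc, this])
    have b1 : star v * w = 0 := by
      calc star v * w = star v * v * star v * w := by rw [hsv]
        _ = star v * (v * star v * w) := by noncomm_ring
        _ = 0 := by rw [a1, mul_zero]
    have b2 : w * star v = 0 := by
      calc w * star v = w * (star v * v * star v) := by rw [hsv]
        _ = w * (star v * v) * star v := by noncomm_ring
        _ = 0 := by rw [a2, zero_mul]
    have b1' : star w * v = 0 := by simpa using congrArg star b1
    have b2' : v * star w = 0 := by simpa using congrArg star b2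
    have hnew : (v + w) * star (v + w) * (v + w) = v + w := by
      rw [star_add]
      calc (v + w) * (star v + star w) * (v + w)
          = v * star v * v + v * (star v * w) + v * star w * v + v * star w * w
            + w * star v * v + w * star v * w + w * (star w * v) + w * star w * w := by noncomm_ring
        _ = v + w := by rw [hvv, b1, b2, b1', b2', hww]; simp
    have hmax := hm ⟨v + w, add_mem hvM hwM, hnew, by rw [mul_add, hpv, a3],
      by rw [add_mul, hvq, a4]⟩ (by
        change (v + w) * (star v * v) = v
        rw [add_mul, ← mul_assoc, hvv, a2, add_zero])
    have h2 : v * (star (v + w) * (v + w)) = v + w := hmax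
    rw [star_add] at h2
    have h3 : v * ((star v + star w) * (v + w)) = v := by
      calc v * ((star v + star w) * (v + w))
          = v * star v * v + v * (star v * w) + v * star w * v + v * star w * w := by noncomm_ring
        _ = v := by rw [hvv, b1, b2']; simp
    rw [h3] at h2
    exact hw0 (left_eq_add.1 h2)
  rcases factor_zero M hf (sub_mem hq (mul_mem (star_mem hvM) hvM)) hzero with h | h
  · left; exact (sub_eq_zero.1 h).symm
  · right; exact (sub_eq_zero.1 h).symm

end Cmp

end CD

namespace CD

section Normal

variable {H : Type} [NormedAddCommGroup H] [InnerProductSpace ℂ H] [CompleteSpace H]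

theorem exists_sqrt (M : VonNeumannAlgebra H) {x : H →L[ℂ] H} (hx : x ∈ M) (h0 : 0 ≤ x) :
    ∃ s ∈ M, star s = s ∧ s * s = x := by
  have hsa : IsSelfAdjoint x := IsSelfAdjoint.of_nonneg h0
  refine ⟨cfc Real.sqrt x, cfc_mem M hx _, (cfc_predicate Real.sqrt x : IsSelfAdjoint _).star_eq, ?_⟩
  rw [← cfc_mul _ _ x Real.continuous_sqrt.continuousOn Real.continuous_sqrt.continuousOn]
  conv_rhs => rw [← cfc_id' ℝ x]
  apply cfc_congr
  intro t ht
  exact Real.mul_self_sqrt (spectrum_nonneg_of_nonneg h0 ht)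

theorem re_inner_star_mul (s : H →L[ℂ] H) (ζ : H) :
    (inner ℂ ((star s * s) ζ) ζ).re = ‖s ζ‖ ^ 2 := by
  rw [ContinuousLinearMap.star_eq_adjoint]
  have : inner ℂ ((ContinuousLinearMap.adjoint s * s) ζ) ζ = inner ℂ (s ζ) (s ζ) := by
    simp [ContinuousLinearMap.adjoint_inner_left]
  rw [this]
  exact inner_self_eq_norm_sq (𝕜 := ℂ) (s ζ)

theorem tau_nonneg (M : VonNeumannAlgebra H) (tr : TraceOn H (M : Set (H →L[ℂ] H)))
    {x : H →L[ℂ] H} (hx : x ∈ M) (h0 : 0 ≤ x) : 0 ≤ (tr.τ x).re := by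
  obtain ⟨s, hs, h1, h2⟩ := exists_sqrt M hx h0
  have := (tr.nonneg s hs).1
  rwa [h1, h2] at this

theorem sq_le_inner {d : H →L[ℂ] H} (h0 : 0 ≤ d) (h1 : d ≤ 1) (ζ : H) :
    ‖d ζ‖ ^ 2 ≤ (inner ℂ (d ζ) ζ).re := by
  have hn : ‖d‖ ≤ 1 := (CStarAlgebra.norm_le_one_iff_of_nonneg d h0).2 h1
  have hsa : IsSelfAdjoint d := IsSelfAdjoint.of_nonneg h0
  obtain ⟨s, hs, hss⟩ : ∃ s : H →L[ℂ] H, star s = s ∧ s * s = d := by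
    refine ⟨cfc Real.sqrt d, (cfc_predicate Real.sqrt d : IsSelfAdjoint _).star_eq, ?_⟩
    rw [← cfc_mul _ _ d Real.continuous_sqrt.continuousOn Real.continuous_sqrt.continuousOn]
    conv_rhs => rw [← cfc_id' ℝ d]
    apply cfc_congr
    intro t ht
    exact Real.mul_self_sqrt (spectrum_nonneg_of_nonneg h0 ht)
  have hsn : ‖s‖ ≤ 1 := by
    have : ‖star s * s‖ = ‖s‖ * ‖s‖ := CStarRing.norm_star_mul_self
    rw [hs, hss] at this
    nlinarith [norm_nonneg s]
  have h3 := re_inner_star_mul s ζ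
  rw [hs, hss] at h3
  rw [h3, ← hss]
  have := s.le_of_opNorm_le hsn (s ζ)
  gcongr
  simpa using this

open Filter Topology in
theorem lim_nonneg {ι : Type} [Preorder ι] [IsDirectedOrder ι] [Nonempty ι]
    (w : ι → (H →L[ℂ] H)) (v : H →L[ℂ] H) (hw : ∀ᶠ i in atTop, 0 ≤ w i)
    (hv : ∀ ξ, Tendsto (fun i => w i ξ) atTop (𝓝 (v ξ))) : 0 ≤ v := by
  rw [ContinuousLinearMap.nonneg_iff_isPositive, ContinuousLinearMap.isPositive_def]
  constructor
  · intro ξ η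
    refine tendsto_nhds_unique ((hv ξ).inner tendsto_const_nhds)
      (Tendsto.congr' ?_ (Tendsto.inner tendsto_const_nhds (hv η)))
    filter_upwards [hw] with i hi
    rw [ContinuousLinearMap.nonneg_iff_isPositive] at hi
    exact (hi.isSymmetric ξ η).symm
  · intro ξ
    have h1 : Tendsto (fun i => (inner ℂ (w i ξ) ξ).re) atTop (𝓝 (inner ℂ (v ξ) ξ).re) :=
      (Complex.continuous_re.tendsto _).comp ((hv ξ).inner tendsto_const_nhds)
    refine ge_of_tendsto h1 ?_
    filter_upwards [hw] with i hi
    rw [ContinuousLinearMap.nonneg_iff_isPositive] at hi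
    exact hi.re_inner_nonneg_left ξ

theorem re_inner_mono {a b : H →L[ℂ] H} (h : a ≤ b) (ζ : H) :
    (inner ℂ (a ζ) ζ).re ≤ (inner ℂ (b ζ) ζ).re := by
  have h1 := (ContinuousLinearMap.le_def a b).1 h
  have h2 := h1.re_inner_nonneg_left ζ
  simp only [ContinuousLinearMap.sub_apply, inner_sub_left, map_sub] at h2
  exact sub_nonneg.1 h2

open Filter Topology in
theorem dominate (M : VonNeumannAlgebra H) (tr : TraceOn H (M : Set (H →L[ℂ] H))) :
    ∃ c ∈ M, 0 ≤ c ∧ c ≠ 0 ∧ ∃ ξ : H, ∀ x ∈ M, 0 ≤ x → x ≤ c →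
      (tr.τ x).re ≤ 2 * (inner ℂ (x ξ) ξ).re := by
  have hnt : Nontrivial H := by
    by_contra hcon
    rw [not_nontrivial_iff_subsingleton] at hcon
    have : (1 : H →L[ℂ] H) = 0 := by ext ξ; exact Subsingleton.elim _ _
    have h1 := tr.unital
    rw [this, map_zero] at h1
    exact zero_ne_one h1
  obtain ⟨ξ, hξ⟩ : ∃ ξ : H, ‖ξ‖ = 1 := by
    obtain ⟨x, hx⟩ := exists_ne (0 : H)
    exact ⟨((‖x‖ : ℂ)⁻¹) • x, norm_smul_inv_norm hx⟩
  let α := {a : H →L[ℂ] H // a ∈ M ∧ 0 ≤ a ∧ a ≤ 1 ∧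
    2 * (inner ℂ (a ξ) ξ).re ≤ (tr.τ a).re}
  let r : α → α → Prop := fun a b => a.1 ≤ b.1
  obtain ⟨m, hm⟩ := exists_maximal_of_chains_bounded (r := r) (by
    intro c hc
    rcases c.eq_empty_or_nonempty with rfl | hne
    · exact ⟨⟨0, zero_mem M, le_rfl, zero_le_one, by simp⟩, by simp⟩
    · obtain ⟨ι, _, _, _, f, hfc, hcf, hmono⟩ := chain_dir r (fun a => le_refl a.1)
        (fun a b c => le_trans) c hc hne
      obtain ⟨v, hv⟩ := exists_lim (fun i : ι => (f i).1)
        (fun i => (CStarAlgebra.norm_le_one_iff_of_nonneg _ (f i).2.2.1).2 (f i).2.2.2.1)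
        (fun ζ i => (inner ℂ ((f i).1 ζ) ζ).re) (by
          intro ζ
          refine ⟨(inner ℂ ((1 : H →L[ℂ] H) ζ) ζ).re, ?_⟩
          rintro _ ⟨i, rfl⟩
          exact re_inner_mono (f i).2.2.2.1 ζ) (by
          intro ζ i j hij
          have h1 := hmono i j hij
          have h2 := sq_le_inner (d := (f j).1 - (f i).1) (sub_nonneg.2 h1)
            (le_trans (sub_le_self _ (f i).2.2.1) (f j).2.2.2.1) ζ
          simpa [inner_sub_left] using h2)
      have hle : ∀ i, (f i).1 ≤ v := by
        intro i
        rw [← sub_nonneg]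
        refine lim_nonneg (fun j => (f j).1 - (f i).1) _ ?_ (fun ζ => (hv ζ).sub_const _)
        filter_upwards [Ici_mem_atTop i] with j hj
        exact sub_nonneg.2 (hmono i j hj)
      have hv0 : 0 ≤ v := lim_nonneg _ v (Eventually.of_forall fun i => (f i).2.2.1) hv
      have hvM : v ∈ M := lim_mem M _ (fun i : ι => (f i).2.1) v hv
      have hv1 : v ≤ 1 := by
        rw [← sub_nonneg]
        exact lim_nonneg (fun j => 1 - (f j).1) _
          (Eventually.of_forall fun j => sub_nonneg.2 (f j).2.2.2.1)
          (fun ζ => (hv ζ).const_sub _)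
      refine ⟨⟨v, hvM, hv0, hv1, ?_⟩, ?_⟩
      · have h1 : Tendsto (fun i => 2 * (inner ℂ ((f i).1 ξ) ξ).re) atTop
            (𝓝 (2 * (inner ℂ (v ξ) ξ).re)) :=
          ((Complex.continuous_re.tendsto _).comp ((hv ξ).inner tendsto_const_nhds)).const_mul 2
        refine le_of_tendsto h1 (Eventually.of_forall fun i => ?_)
        have h2 := tau_nonneg M tr (sub_mem hvM (f i).2.1) (sub_nonneg.2 (hle i))
        rw [map_sub, Complex.sub_re] at h2
        have h3 := (f i).2.2.2.2
        linarith
      · intro a ha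
        obtain ⟨i, rfl⟩ := hcf a ha
        exact hle i) (fun {a b c} h1 h2 => le_trans (a := a.1) (b := b.1) (c := c.1) h1 h2)
  obtain ⟨a, haM, ha0, ha1, hat⟩ := m
  refine ⟨1 - a, sub_mem (one_mem M) haM, sub_nonneg.2 ha1, ?_, ξ, ?_⟩
  · intro h
    have h1 : a = 1 := (sub_eq_zero.1 h).symm
    rw [h1, tr.unital] at hat
    have : (inner ℂ ((1 : H →L[ℂ] H) ξ) ξ).re = ‖ξ‖ ^ 2 := inner_self_eq_norm_sq (𝕜 := ℂ) ξ
    rw [this, hξ] at hat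
    norm_num at hat
  · intro x hx hx0 hxc
    by_contra hcon
    push Not at hcon
    have h1 := hm ⟨a + x, add_mem haM hx, add_nonneg ha0 hx0, le_sub_iff_add_le'.1 hxc, by
      simp only [ContinuousLinearMap.add_apply, inner_add_left, Complex.add_re, map_add]
      linarith⟩ (le_add_of_nonneg_right hx0)
    have h2 : a + x ≤ a := h1
    have h3 : x ≤ 0 := by simpa using h2
    have h4 : x = 0 := le_antisymm h3 hx0
    rw [h4] at hcon
    simp at hcon

theorem dominate2 (M : VonNeumannAlgebra H) (tr : TraceOn H (M : Set (H →L[ℂ] H))) :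
    ∃ e ∈ M, e ≠ 0 ∧ star e = e ∧ e * e = e ∧ ∃ η : H, ∀ z ∈ M,
      (tr.τ (star (z * e) * (z * e))).re ≤ 2 * ‖z η‖ ^ 2 := by
  obtain ⟨c, hcM, hc0, hcne, ξ, hξ⟩ := dominate M tr
  obtain ⟨s, hsM, hs, hss⟩ := exists_sqrt M hcM hc0
  have key1 : ∀ z ∈ M, ‖z‖ ≤ 1 → (tr.τ (star (z * s) * (z * s))).re ≤ 2 * ‖z (s ξ)‖ ^ 2 := by
    intro z hz hzn
    have h1 : star z * z ≤ 1 := by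
      apply (CStarAlgebra.norm_le_one_iff_of_nonneg _ (star_mul_self_nonneg z)).1
      rw [CStarRing.norm_star_mul_self]
      nlinarith [norm_nonneg z]
    have h2 : star (z * s) * (z * s) ≤ c := by
      have := star_left_conjugate_le_conjugate h1 s
      rw [mul_one, hs, hss] at this
      rw [star_mul, hs]
      simpa [mul_assoc] using this
    have h3 := hξ _ (mul_mem (star_mem (mul_mem hz hsM)) (mul_mem hz hsM))
      (star_mul_self_nonneg _) h2
    rw [re_inner_star_mul] at h3
    exact h3
  have key : ∀ z ∈ M, (tr.τ (star (z * s) * (z * s))).re ≤ 2 * ‖z (s ξ)‖ ^ 2 := by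
    intro z hz
    set t : ℝ := ‖z‖ + 1 with ht
    have htp : 0 < t := by positivity
    have h1 := key1 (((t⁻¹ : ℝ) : ℂ) • z) (smul_mem' M _ hz) (by
      rw [norm_smul, Complex.norm_real, Real.norm_of_nonneg (by positivity), inv_mul_le_iff₀ htp]
      linarith)
    have h2 : star ((((t⁻¹ : ℝ) : ℂ) • z) * s) * ((((t⁻¹ : ℝ) : ℂ) • z) * s)
        = (((t⁻¹ * t⁻¹ : ℝ)) : ℂ) • (star (z * s) * (z * s)) := by
      rw [smul_mul_assoc, star_smul, smul_mul_smul_comm]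
      congr 1
      simp
    rw [h2, map_smul, smul_eq_mul, Complex.re_ofReal_mul, ContinuousLinearMap.smul_apply,
      norm_smul, Complex.norm_real, Real.norm_of_nonneg (by positivity), mul_pow] at h1
    have h3 : 0 < t⁻¹ * t⁻¹ := by positivity
    have h4 : t⁻¹ * t⁻¹ * (tr.τ (star (z * s) * (z * s))).re
        ≤ t⁻¹ * t⁻¹ * (2 * ‖z (s ξ)‖ ^ 2) := by
      calc _ ≤ _ := h1
        _ = _ := by ring
    exact le_of_mul_le_mul_left h4 h3
  obtain ⟨e, he, k, hk, e0, es, ee, ks, kc, cke, _⟩ := exists_cut M hcM hc0 hcne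
  refine ⟨e, he, e0, es, ee, e ξ, ?_⟩
  have hfac : e * k * k * s * s = e := by
    have := congrArg star cke
    simp only [star_mul, es, ks] at this
    have hcs : star c = c := by rw [← hss, star_mul, hs]
    rw [hcs, ← hss] at this
    simpa [mul_assoc] using this
  intro z hz
  have h1 := key (z * (e * k * k * s)) (mul_mem hz (mul_mem (mul_mem (mul_mem he hk) hk) hsM))
  rw [mul_assoc z, hfac] at h1
  have h2 : (z * (e * k * k * s)) (s ξ) = z (e ξ) := by
    have := congrArg (fun T : H →L[ℂ] H => z (T ξ)) hfac
    simpa using this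
  rwa [h2] at h1

theorem cover (M : VonNeumannAlgebra H) (hf : IsFactorSet (M : Set (H →L[ℂ] H)))
    (tr : TraceOn H (M : Set (H →L[ℂ] H))) {e : H →L[ℂ] H}
    (he : e ∈ M) (es : star e = e) (ee : e * e = e) (N : ℕ) :
    ∀ r ∈ M, star r = r → r * r = r → (tr.τ r).re ≤ N * (tr.τ e).re →
      ∃ (m : ℕ) (v : Fin m → (H →L[ℂ] H)), (∀ j, v j ∈ M) ∧ (∀ j, v j * e = v j) ∧
        r = ∑ j, v j * star (v j) := by
  induction N with
  | zero =>
    intro r hr rs rr hle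
    refine ⟨0, Fin.elim0, fun j => j.elim0, fun j => j.elim0, ?_⟩
    have h1 := tr.nonneg r hr
    have h2 := tr.faithful r hr (by
      rw [rs, rr] at h1 ⊢
      apply Complex.ext
      · simp at hle
        simpa using le_antisymm hle h1.1
      · simpa using h1.2)
    simp [h2]
  | succ N ih =>
    intro r hr rs rr hle
    obtain ⟨v, hv, hvv, hrv, hve, h | h⟩ := comparison M hf hr rs rr he es ee
    · exact ⟨1, fun _ => v, fun _ => hv, fun _ => hve, by simp [h]⟩
    · have hvr : star v * r = star v := by
        have := congrArg star hrv
        rwa [star_mul, rs] at this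
      have hvvM := mul_mem hv (star_mem hv)
      obtain ⟨m, w, hw1, hw2, hw3⟩ := ih (r - v * star v) (sub_mem hr hvvM)
        (by simp [rs]) (by
          calc (r - v * star v) * (r - v * star v)
              = r * r - r * v * star v - v * (star v * r) + (v * star v * v) * star v := by
                noncomm_ring
            _ = _ := by rw [rr, hrv, hvr, hvv]; abel) (by
          rw [map_sub, tr.tracial v hv _ (star_mem hv), h, Complex.sub_re]
          push_cast at hle
          linarith)
      refine ⟨m + 1, Fin.cons v w, ?_, ?_, ?_⟩
      · intro j; refine Fin.cases ?_ ?_ j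
        · simpa using hv
        · intro i; simpa using hw1 i
      · intro j; refine Fin.cases ?_ ?_ j
        · simpa using hve
        · intro i; simpa using hw2 i
      · rw [Fin.sum_univ_succ]
        simp only [Fin.cons_zero, Fin.cons_succ]
        rw [← hw3]; abel

theorem trace_bound (M : VonNeumannAlgebra H) (hf : IsFactorSet (M : Set (H →L[ℂ] H)))
    (tr : TraceOn H (M : Set (H →L[ℂ] H))) :
    ∃ (m : ℕ) (η : Fin m → H), ∀ z ∈ M,
      (tr.τ (star z * z)).re ≤ 2 * ∑ j, ‖z (η j)‖ ^ 2 := by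
  obtain ⟨e, he, e0, es, ee, η, hη⟩ := dominate2 M tr
  have hpos : 0 < (tr.τ e).re := by
    have h1 := tr.nonneg e he
    have h2 := tr.faithful e he
    rw [es, ee] at h1 h2
    refine lt_of_le_of_ne h1.1 ?_
    intro h
    exact e0 (h2 (Complex.ext h.symm h1.2))
  obtain ⟨N, hN⟩ := exists_nat_ge (1 / (tr.τ e).re)
  obtain ⟨m, v, hv, hve, hsum⟩ := cover M hf tr he es ee N 1 (one_mem M) (by simp) (by simp) (by
    rw [tr.unital, Complex.one_re]
    rwa [div_le_iff₀ hpos] at hN)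
  refine ⟨m, fun j => v j η, ?_⟩
  intro z hz
  have h1 : tr.τ (star z * z) = ∑ j, tr.τ (star (z * v j * e) * (z * v j * e)) := by
    rw [← map_sum]
    conv_lhs => rw [← mul_one (star z * z), hsum, Finset.mul_sum]
    rw [map_sum, map_sum]
    refine Finset.sum_congr rfl fun j _ => ?_
    rw [← mul_assoc (star z * z), tr.tracial _ (mul_mem (mul_mem (star_mem hz) hz) (hv j)) _
      (star_mem (hv j)), mul_assoc z, hve, star_mul]
    simp only [mul_assoc]
  rw [h1, Complex.re_sum, Finset.mul_sum]
  refine Finset.sum_le_sum fun j _ => ?_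
  exact hη (z * v j) (mul_mem hz (hv j))

end Normal

end CD

namespace CD

section Density

variable {H : Type} [NormedAddCommGroup H] [InnerProductSpace ℂ H] [CompleteSpace H]

def dg {m : ℕ} (y : H →L[ℂ] H) (ζ : PiLp 2 (fun _ : Fin m => H)) : PiLp 2 (fun _ : Fin m => H) :=
  WithLp.toLp 2 (fun j => y (ζ j))

theorem density (V : Submodule ℂ (H →L[ℂ] H)) (h1 : (1 : H →L[ℂ] H) ∈ V)
    (hmul : ∀ x ∈ V, ∀ y ∈ V, x * y ∈ V) (hstar : ∀ x ∈ V, star x ∈ V)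
    {x : H →L[ℂ] H} (hx : x ∈ vnGen (V : Set (H →L[ℂ] H))) {m : ℕ} (η : Fin m → H)
    {ε : ℝ} (hε : 0 < ε) : ∃ y ∈ V, ∑ j, ‖(x - y) (η j)‖ ^ 2 < ε := by
  let K := PiLp 2 (fun _ : Fin m => H)
  have hdc : ∀ y : H →L[ℂ] H, Continuous (dg (m := m) y) := by
    intro y
    unfold dg
    fun_prop
  let L : (H →L[ℂ] H) →ₗ[ℂ] K :=
    { toFun := fun y => WithLp.toLp 2 (fun j => y (η j))
      map_add' := by intro a b; rfl
      map_smul' := by intro a b; rfl }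
  let W0 : Submodule ℂ K := V.map L
  let W := W0.topologicalClosure
  have hWc : IsClosed (W : Set K) := W0.isClosed_topologicalClosure
  have : CompleteSpace W := hWc.completeSpace_coe
  let P : K →L[ℂ] K := W.starProjection
  have hinv : ∀ y ∈ V, ∀ ζ ∈ W, dg y ζ ∈ W := by
    intro y hy ζ hζ
    have hmaps : Set.MapsTo (dg (m := m) y) (W0 : Set K) (W0 : Set K) := by
      rintro _ ⟨z, hz, rfl⟩
      exact ⟨y * z, hmul y hy z hz, rfl⟩
    have := hmaps.closure (hdc y)
    exact this hζ
  have hadj : ∀ (y : H →L[ℂ] H) (ζ ζ' : K), inner ℂ (dg y ζ) ζ' = inner ℂ ζ (dg (star y) ζ') := by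
    intro y ζ ζ'
    rw [PiLp.inner_apply, PiLp.inner_apply]
    refine Finset.sum_congr rfl fun j _ => ?_
    simp only [dg]
    rw [ContinuousLinearMap.star_eq_adjoint, ContinuousLinearMap.adjoint_inner_right]
  have hadd : ∀ (y : H →L[ℂ] H) (ζ ζ' : K), dg y (ζ - ζ') = dg y ζ - dg y ζ' := by
    intro y ζ ζ'
    ext j
    exact map_sub y (ζ j) (ζ' j)
  have hcomm : ∀ y ∈ V, ∀ ζ, P (dg y ζ) = dg y (P ζ) := by
    intro y hy ζ
    refine Submodule.eq_starProjection_of_mem_orthogonal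
      (hinv y hy _ (W.starProjection_apply_mem ζ)) ?_
    rw [← hadd, Submodule.mem_orthogonal]
    intro w hw
    have h2 := hinv (star y) (hstar y hy) w hw
    have h3 := hadj (star y) w (ζ - P ζ)
    rw [star_star] at h3
    rw [← h3]
    exact (Submodule.mem_orthogonal _ _).1 (W.sub_starProjection_mem_orthogonal ζ) _ h2
  let ι : Fin m → (H →L[ℂ] K) := fun j =>
    ((PiLp.continuousLinearEquiv 2 ℂ (fun _ : Fin m => H)).symm : (Fin m → H) →L[ℂ] K).comp
      (ContinuousLinearMap.single ℂ (fun _ : Fin m => H) j)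
  have hι : ∀ j (h : H) (i : Fin m), (ι j h) i = if i = j then h else 0 := by
    intro j h i
    simp only [ι]
    by_cases hij : i = j
    · subst hij; simp
    · simp [hij]
  have hιy : ∀ (y : H →L[ℂ] H) j h, ι j (y h) = dg y (ι j h) := by
    intro y j h
    ext i
    simp only [dg]
    rw [hι, hι]
    split_ifs <;> simp
  have hdec : ∀ ζ : K, ζ = ∑ j, ι j (ζ j) := by
    intro ζ
    ext i
    rw [WithLp.ofLp_sum, Finset.sum_apply, Finset.sum_eq_single i]
    · rw [hι]; simp
    · intro j _ hj
      rw [hι, if_neg (Ne.symm hj)]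
    · simp
  let Pe : Fin m → Fin m → (H →L[ℂ] H) := fun i j =>
    (PiLp.proj 2 (𝕜 := ℂ) (fun _ : Fin m => H) i).comp (P.comp (ι j))
  have hPe : ∀ i j h, Pe i j h = (P (ι j h)) i := fun i j h => rfl
  have hPc : ∀ i j, Pe i j ∈ Set.centralizer (V : Set (H →L[ℂ] H)) := by
    intro i j y hy
    ext h
    change y (Pe i j h) = Pe i j (y h)
    rw [hPe, hPe, hιy, hcomm y hy]
    rfl
  have hPx : ∀ i j h, Pe i j (x h) = x (Pe i j h) := by
    intro i j h
    exact congrArg (fun T : H →L[ℂ] H => T h) (hx _ (hPc i j))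
  have hxc : ∀ ζ : K, P (dg x ζ) = dg x (P ζ) := by
    intro ζ
    ext i
    have e1 : ∀ ζ' : K, (P ζ') i = ∑ j, Pe i j (ζ' j) := by
      intro ζ'
      conv_lhs => rw [hdec ζ']
      rw [map_sum, WithLp.ofLp_sum, Finset.sum_apply]
      rfl
    rw [e1]
    change _ = x ((P ζ) i)
    rw [e1, map_sum]
    exact Finset.sum_congr rfl fun j _ => hPx i j _
  have hη : L 1 ∈ W := W0.le_topologicalClosure ⟨1, h1, rfl⟩
  have hxW : L x ∈ W := by
    have e2 : L x = dg x (L 1) := rfl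
    have e3 : P (L 1) = L 1 := Submodule.starProjection_eq_self_iff.2 hη
    rw [e2]
    refine Submodule.starProjection_eq_self_iff.1 ?_
    change P _ = _
    rw [hxc, e3]
  obtain ⟨_, ⟨y, hy, rfl⟩, hd⟩ := Metric.mem_closure_iff.1 hxW (Real.sqrt ε) (Real.sqrt_pos.2 hε)
  refine ⟨y, hy, ?_⟩
  rw [dist_eq_norm, ← map_sub] at hd
  have h3 : ‖L (x - y)‖ ^ 2 = ∑ j, ‖(x - y) (η j)‖ ^ 2 := by
    rw [PiLp.norm_sq_eq_of_L2]
    rfl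
  rw [← h3]
  calc _ < (Real.sqrt ε) ^ 2 := by gcongr
    _ = ε := Real.sq_sqrt hε.le

/-- Lemma D. -/
theorem normal_zero (M : VonNeumannAlgebra H) (hf : IsFactorSet (M : Set (H →L[ℂ] H)))
    (tr : TraceOn H (M : Set (H →L[ℂ] H))) (V : Submodule ℂ (H →L[ℂ] H))
    (h1 : (1 : H →L[ℂ] H) ∈ V) (hVM : ∀ y ∈ V, y ∈ M)
    (hmul : ∀ x ∈ V, ∀ y ∈ V, x * y ∈ V) (hstar : ∀ x ∈ V, star x ∈ V)
    {x : H →L[ℂ] H} (hxM : x ∈ M) (hx : x ∈ vnGen (V : Set (H →L[ℂ] H)))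
    (h0 : ∀ y ∈ V, tr.τ (y * x) = 0) : x = 0 := by
  obtain ⟨m, η, hη⟩ := trace_bound M hf tr
  have hn := tr.nonneg x hxM
  apply tr.faithful x hxM
  refine Complex.ext (le_antisymm ?_ hn.1) hn.2
  simp only [Complex.zero_re]
  refine le_of_forall_pos_le_add fun ε hε => ?_
  obtain ⟨y, hy, hlt⟩ := density V h1 hmul hstar hx η (half_pos hε)
  have hyM := hVM y hy
  have b1 := hη (x - y) (sub_mem hxM hyM)
  have b2 : tr.τ (star (x - y) * (x - y)) = tr.τ (star x * x) + tr.τ (star y * y) := by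
    have e1 : tr.τ (star y * x) = 0 := h0 _ (hstar y hy)
    have e2 : tr.τ (star x * y) = 0 := by
      have := tr.star_eq _ (mul_mem (star_mem hyM) hxM)
      rw [e1] at this
      simpa using this
    rw [star_sub]
    have : (star x - star y) * (x - y) = star x * x - star x * y - star y * x + star y * y := by
      noncomm_ring
    rw [this]
    simp [e1, e2]
  rw [b2, Complex.add_re] at b1
  have := (tr.nonneg y hyM).1
  linarith

end Density

end CD

namespace CD

section Crossed

variable {H : Type} [NormedAddCommGroup H] [InnerProductSpace ℂ H] [CompleteSpace H]
variable {Γ : Type} [Group Γ]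

theorem bessel (M : VonNeumannAlgebra H) (tr : TraceOn H (M : Set (H →L[ℂ] H)))
    {ι : Type} (z : ι → (H →L[ℂ] H)) (hz : ∀ i, z i ∈ M) {k : ℝ} (hk : 0 < k)
    (horth : ∀ i j, tr.τ (star (z i) * z j) = if i = j then (k : ℂ) else 0)
    {x : H →L[ℂ] H} (hx : x ∈ M) (c : ℂ) (F : Finset ι)
    (hc : ∀ i ∈ F, tr.τ (star (z i) * x) = c) :
    (F.card : ℝ) * ‖c‖ ^ 2 ≤ k * (tr.τ (star x * x)).re := by
  set y := ∑ i ∈ F, z i with hy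
  have hyM : y ∈ M := sum_mem fun i _ => hz i
  have h1 : tr.τ (star y * x) = F.card * c := by
    rw [hy, star_sum, Finset.sum_mul, map_sum, Finset.sum_congr rfl hc]
    simp
  have h2 : tr.τ (star x * y) = F.card * (starRingEnd ℂ) c := by
    have := tr.star_eq _ (mul_mem (star_mem hyM) hx)
    rw [h1, star_mul, star_star] at this
    rw [this]
    simp
  have h3 : tr.τ (star y * y) = F.card * k := by
    rw [hy, star_sum, Finset.sum_mul, map_sum]
    have : ∀ i ∈ F, tr.τ (star (z i) * ∑ j ∈ F, z j) = k := by
      intro i hi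
      rw [Finset.mul_sum, map_sum, Finset.sum_congr rfl (fun j _ => horth i j)]
      simp [hi]
    rw [Finset.sum_congr rfl this]
    simp
  have h4 := (tr.nonneg (x - (c / k) • y) (sub_mem hx (smul_mem' M _ hyM))).1
  have h5 : star (x - (c / k) • y) * (x - (c / k) • y) = star x * x - (c / k) • (star x * y)
      - (starRingEnd ℂ (c / k)) • (star y * x) + (starRingEnd ℂ (c / k) * (c / k)) • (star y * y) := by
    rw [star_sub, star_smul, sub_mul, mul_sub, mul_sub, mul_smul_comm, smul_mul_assoc,
      smul_mul_smul_comm]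
    simp only [starRingEnd_apply]
    abel
  have hk' : (k : ℂ) ≠ 0 := by exact_mod_cast hk.ne'
  have h6 : tr.τ (star (x - (c / k) • y) * (x - (c / k) • y))
      = tr.τ (star x * x) - ((F.card * ‖c‖ ^ 2 / k : ℝ) : ℂ) := by
    rw [h5]
    simp only [map_add, map_sub, map_smul, smul_eq_mul, h1, h2, h3, map_div₀, Complex.conj_ofReal]
    have h7 : (starRingEnd ℂ) c * c = ((‖c‖ ^ 2 : ℝ) : ℂ) := by
      rw [mul_comm, Complex.mul_conj, Complex.normSq_eq_norm_sq]
    push_cast at h7 ⊢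
    rw [← h7]
    field_simp
    ring
  rw [h6, Complex.sub_re, Complex.ofReal_re] at h4
  have : F.card * ‖c‖ ^ 2 / k ≤ (tr.τ (star x * x)).re := by linarith
  rw [div_le_iff₀ hk] at this
  linarith

structure Atoms (X : CrossedProduct Γ H) (n : ℕ) (e : Fin n → (H →L[ℂ] H)) : Prop where
  icc : IsICC Γ
  fac : IsFactorSet (X.M : Set (H →L[ℂ] H))
  mem : ∀ i, e i ∈ X.A
  st : ∀ i, star (e i) = e i
  idem : ∀ i, e i * e i = e i
  ne : ∀ i, e i ≠ 0
  orth : ∀ i j, i ≠ j → e i * e j = 0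
  sum : ∑ i, e i = 1
  span : ∀ a ∈ X.A, ∃ c : Fin n → ℂ, a = ∑ i, c i • e i
  trans : ∀ i j, ∃ γ : Γ, X.σ γ (e i) = e j

namespace CrossedProduct

variable (X : CrossedProduct Γ H)

theorem u_mul_star (γ : Γ) : X.u γ * star (X.u γ) = 1 := by
  rw [X.u_star, X.u_mul, mul_inv_cancel, X.u_one]

theorem star_mul_u (γ : Γ) : star (X.u γ) * X.u γ = 1 := by
  rw [X.u_star, X.u_mul, inv_mul_cancel, X.u_one]

theorem σ_one (x : H →L[ℂ] H) : X.σ 1 x = x := by simp [σ, X.u_one]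

theorem σ_comp (γ δ : Γ) (x : H →L[ℂ] H) : X.σ γ (X.σ δ x) = X.σ (γ * δ) x := by
  simp only [σ]
  rw [← X.u_mul, star_mul]
  noncomm_ring

theorem σ_inv (γ : Γ) (x : H →L[ℂ] H) : X.σ γ⁻¹ (X.σ γ x) = x := by
  rw [σ_comp, inv_mul_cancel, σ_one]

theorem σ_inv' (γ : Γ) (x : H →L[ℂ] H) : X.σ γ (X.σ γ⁻¹ x) = x := by
  rw [σ_comp, mul_inv_cancel, σ_one]

theorem u_mul' (γ : Γ) (x : H →L[ℂ] H) : X.u γ * x = X.σ γ x * X.u γ := by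
  rw [σ, mul_assoc, star_mul_u, mul_one]

theorem σ_mul (γ : Γ) (x y : H →L[ℂ] H) : X.σ γ (x * y) = X.σ γ x * X.σ γ y := by
  simp only [σ]
  calc X.u γ * (x * y) * star (X.u γ) = X.u γ * x * 1 * y * star (X.u γ) := by noncomm_ring
    _ = _ := by rw [← X.star_mul_u γ]; noncomm_ring

theorem σ_smul (γ : Γ) (c : ℂ) (x : H →L[ℂ] H) : X.σ γ (c • x) = c • X.σ γ x := by
  simp [σ]

theorem σ_sum {ι : Type} (s : Finset ι) (γ : Γ) (x : ι → (H →L[ℂ] H)) :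
    X.σ γ (∑ i ∈ s, x i) = ∑ i ∈ s, X.σ γ (x i) := by
  simp [σ, Finset.mul_sum, Finset.sum_mul]

theorem σ_star (γ : Γ) (x : H →L[ℂ] H) : X.σ γ (star x) = star (X.σ γ x) := by
  simp [σ, mul_assoc]

theorem σ_eq_iff (γ : Γ) (x : H →L[ℂ] H) : X.σ γ x = x ↔ X.u γ * x = x * X.u γ := by
  constructor
  · intro h
    rw [u_mul', h]
  · intro h
    rw [σ, h, mul_assoc, u_mul_star, mul_one]

theorem σ_memM (γ : Γ) {x : H →L[ℂ] H} (hx : x ∈ X.M) : X.σ γ x ∈ X.M :=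
  mul_mem (mul_mem (X.u_mem γ) hx) (star_mem (X.u_mem γ))

theorem τ_σ (γ : Γ) {x : H →L[ℂ] H} (hx : x ∈ X.M) : X.tr.τ (X.σ γ x) = X.tr.τ x := by
  rw [σ, X.tr.tracial _ (mul_mem (X.u_mem γ) hx) _ (star_mem (X.u_mem γ)), ← mul_assoc,
    star_mul_u, one_mul]

theorem u_Lg (γ : Γ) : X.u γ ∈ X.Lg := by
  have : X.u γ ∈ (X.Lg : Set (H →L[ℂ] H)) := by
    rw [X.Lg_eq]
    exact Set.subset_centralizer_centralizer ⟨γ, rfl⟩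
  exact this

theorem Lg_M {x : H →L[ℂ] H} (hx : x ∈ X.Lg) : x ∈ X.M := X.Lg_sub hx

theorem A_M {x : H →L[ℂ] H} (hx : x ∈ X.A) : x ∈ X.M := X.A_sub hx

theorem Lg_comm {x r : H →L[ℂ] H} (hx : x ∈ X.Lg) (hr : ∀ γ, X.u γ * r = r * X.u γ) :
    r * x = x * r := by
  have : x ∈ (X.Lg : Set (H →L[ℂ] H)) := hx
  rw [X.Lg_eq] at this
  refine this r ?_
  rintro _ ⟨γ, rfl⟩
  exact hr γ


theorem τ_a_u {a : H →L[ℂ] H} (ha : a ∈ X.A) {γ : Γ} (hγ : γ ≠ 1) : X.tr.τ (a * X.u γ) = 0 := by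
  have h1 := X.EA.bimod a ha 1 (one_mem X.A) (X.u γ) (X.u_mem γ)
  rw [mul_one, mul_one, X.EA_u γ hγ, mul_zero] at h1
  rw [← X.EA.trace_eq _ (mul_mem (X.A_M ha) (X.u_mem γ)), h1, map_zero]

end CrossedProduct

namespace Atoms

variable {X : CrossedProduct Γ H} {n : ℕ} {e : Fin n → (H →L[ℂ] H)}

theorem memM (h : Atoms X n e) (i : Fin n) : e i ∈ X.M := X.A_M (h.mem i)

theorem mul_span (h : Atoms X n e) (j : Fin n) (c : Fin n → ℂ) : e j * ∑ i, c i • e i = c j • e j := by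
  rw [Finset.mul_sum, Finset.sum_eq_single j]
  · rw [mul_smul_comm, h.idem]
  · intro i _ hi
    rw [mul_smul_comm, h.orth j i (Ne.symm hi), smul_zero]
  · simp

theorem span_mul (h : Atoms X n e) (j : Fin n) (c : Fin n → ℂ) : (∑ i, c i • e i) * e j = c j • e j := by
  rw [Finset.sum_mul, Finset.sum_eq_single j]
  · rw [smul_mul_assoc, h.idem]
  · intro i _ hi
    rw [smul_mul_assoc, h.orth i j hi, smul_zero]
  · simp

theorem perm (h : Atoms X n e) (γ : Γ) (i : Fin n) : ∃ k, X.σ γ (e i) = e k := by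
  obtain ⟨c, hc⟩ := h.span (X.σ γ (e i)) (X.conj_mem γ _ (h.mem i))
  have hf0 : X.σ γ (e i) ≠ 0 := by
    intro h0
    have := X.σ_inv γ (e i)
    rw [h0] at this
    exact h.ne i (by rw [← this]; simp [CrossedProduct.σ])
  obtain ⟨k, hk⟩ : ∃ k, c k ≠ 0 := by
    by_contra hcon
    push Not at hcon
    exact hf0 (by rw [hc]; simp [hcon])
  obtain ⟨d, hd⟩ := h.span (X.σ γ⁻¹ (e k)) (X.conj_mem γ⁻¹ _ (h.mem k))
  have h1 : X.σ γ (e i) * e k = c k • e k := by rw [hc, h.span_mul]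
  have h2 : e i * X.σ γ⁻¹ (e k) = d i • e i := by rw [hd, h.mul_span]
  have h3 := congrArg (X.σ γ) h2
  rw [X.σ_mul, X.σ_inv', X.σ_smul, h1] at h3
  have hd0 : d i ≠ 0 := by
    intro h0
    rw [h0, zero_smul] at h3
    exact (smul_ne_zero hk (h.ne k)) h3
  set f := X.σ γ (e i) with hf
  have hff : f * f = f := by rw [hf, ← X.σ_mul, h.idem]
  have h4 : f = ((d i)⁻¹ * c k) • e k := by
    rw [mul_smul, h3, smul_smul, inv_mul_cancel₀ hd0, one_smul]
  set t := (d i)⁻¹ * c k with ht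
  have ht0 : t ≠ 0 := mul_ne_zero (inv_ne_zero hd0) hk
  have h5 : (t * t) • e k = t • e k := by
    have := hff
    rw [h4, smul_mul_smul_comm, h.idem] at this
    exact this
  have h6 : t * t = t := by
    have : (t * t - t) • e k = 0 := by rw [sub_smul, h5, sub_self]
    exact sub_eq_zero.1 ((smul_eq_zero.1 this).resolve_right (h.ne k))
  have h7 : t = 1 := mul_left_cancel₀ ht0 (by rw [h6, mul_one])
  exact ⟨k, by rw [h4, h7, one_smul]⟩

theorem e_inj (h : Atoms X n e) : Function.Injective e := by
  intro i j hij
  by_contra hne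
  have := h.orth i j hne
  rw [← hij, h.idem] at this
  exact h.ne i this

theorem exists_pi (h : Atoms X n e) : ∃ π : Γ → Fin n → Fin n, (∀ γ i, X.σ γ (e i) = e (π γ i)) ∧
    ∀ γ, Function.Bijective (π γ) := by
  choose π hπ using h.perm
  refine ⟨π, hπ, fun γ => Finite.injective_iff_bijective.1 ?_⟩
  intro i j hij
  apply h.e_inj
  have : X.σ γ (e i) = X.σ γ (e j) := by rw [hπ, hπ, hij]
  rw [← X.σ_inv γ (e i), this, X.σ_inv]

theorem σ_fix (h : Atoms X n e) {γ : Γ} (hγ : ∀ j, X.σ γ (e j) = e j) {a : H →L[ℂ] H} (ha : a ∈ X.A) :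
    X.σ γ a = a := by
  obtain ⟨c, rfl⟩ := h.span a ha
  rw [X.σ_sum]
  refine Finset.sum_congr rfl fun i _ => ?_
  rw [X.σ_smul, hγ]

theorem orbit_inf (h : Atoms X n e) {μ : Γ} (hμ : μ ≠ 1) :
    {g : Γ | ∃ k : Γ, (∀ j, X.σ k (e j) = e j) ∧ g = k * μ * k⁻¹}.Infinite := by
  obtain ⟨π, hπ, -⟩ := h.exists_pi
  intro hfin
  refine h.icc μ hμ ?_
  have hfin2 := (Set.finite_univ (α := Fin n → Fin n)).prod hfin
  refine (hfin2.image (fun p => Function.invFun π p.1 * p.2 * (Function.invFun π p.1)⁻¹)).subset ?_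
  rintro _ ⟨g, rfl⟩
  set g' := Function.invFun π (π g) with hg'
  have h1 : π g' = π g := Function.invFun_eq ⟨g, rfl⟩
  refine ⟨(π g, (g'⁻¹ * g) * μ * (g'⁻¹ * g)⁻¹), ⟨trivial, g'⁻¹ * g, ?_, rfl⟩, ?_⟩
  · intro j
    rw [← X.σ_comp, hπ, ← h1, ← hπ, X.σ_inv]
  · simp only [← hg']
    group

theorem τ_e (h : Atoms X n e) (i : Fin n) : (n : ℂ) * X.tr.τ (e i) = 1 := by
  have h1 : ∀ j, X.tr.τ (e j) = X.tr.τ (e i) := by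
    intro j
    obtain ⟨γ, hγ⟩ := h.trans i j
    rw [← hγ, X.τ_σ γ (h.memM i)]
  have h2 := congrArg X.tr.τ h.sum
  rw [map_sum, X.tr.unital, Finset.sum_congr rfl (fun j _ => h1 j)] at h2
  simpa using h2

theorem n_ne (h : Atoms X n e) : (n : ℂ) ≠ 0 := by
  intro h0
  have hn : n = 0 := by exact_mod_cast h0
  subst hn
  have h1 := h.sum
  have h2 := X.tr.unital
  rw [← h1] at h2
  simp at h2

theorem τ_e' (h : Atoms X n e) (i : Fin n) : X.tr.τ (e i) = (((n : ℝ)⁻¹ : ℝ) : ℂ) := by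
  have := h.τ_e i
  push_cast
  field_simp [h.n_ne]
  rw [mul_comm]; exact this

theorem n_pos (h : Atoms X n e) : (0 : ℝ) < n := by
  have := h.n_ne
  have h2 : n ≠ 0 := by exact_mod_cast this
  exact_mod_cast Nat.pos_of_ne_zero h2

theorem EA_zero (h : Atoms X n e) {x : H →L[ℂ] H} (hx : x ∈ X.M) (h0 : ∀ j, X.tr.τ (e j * x) = 0) :
    X.EA.E x = 0 := by
  obtain ⟨c, hc⟩ := h.span _ (X.EA.mem x hx)
  have h1 : ∀ j, c j = 0 := by
    intro j
    have h2 := X.EA.bimod (e j) (h.mem j) 1 (one_mem X.A) x hx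
    rw [mul_one, mul_one, hc, h.mul_span] at h2
    have h3 := X.EA.trace_eq _ (mul_mem (h.memM j) hx)
    rw [h2, h0, map_smul, smul_eq_mul] at h3
    refine (mul_eq_zero.1 h3).resolve_right ?_
    intro h4
    have := h.τ_e j
    rw [h4] at this
    simp at this
  rw [hc]
  simp [h1]

theorem sep (h : Atoms X n e) {x : H →L[ℂ] H} (hx : x ∈ X.M)
    (h0 : ∀ γ j, X.tr.τ (e j * x * star (X.u γ)) = 0) : x = 0 := by
  refine X.fourier_sep x hx fun γ => ?_
  refine h.EA_zero (mul_mem hx (star_mem (X.u_mem γ))) fun j => ?_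
  rw [← mul_assoc]
  exact h0 γ j

theorem comm_in_A (h : Atoms X n e) {x : H →L[ℂ] H} (hx : x ∈ X.M)
    (hc : ∀ k, (∀ j, X.σ k (e j) = e j) → X.u k * x = x * X.u k) : x ∈ X.A := by
  have hEA := X.EA.mem x hx
  have hEM : X.EA.E x ∈ X.M := X.A_M hEA
  set y := x - X.EA.E x with hy
  have hyM : y ∈ X.M := sub_mem hx hEM
  have hyc : ∀ k, (∀ j, X.σ k (e j) = e j) → X.u k * y = y * X.u k := by
    intro k hk
    rw [hy, mul_sub, sub_mul, hc k hk, (X.σ_eq_iff k _).1 (h.σ_fix hk hEA)]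
  have hy0 : y = 0 := by
    refine h.sep hyM fun γ j => ?_
    by_cases hγ : γ = 1
    · subst hγ
      rw [X.u_one, star_one, mul_one, ← X.EA.trace_eq _ (mul_mem (h.memM j) hyM)]
      have := X.EA.bimod (e j) (h.mem j) 1 (one_mem X.A) y hyM
      rw [mul_one, mul_one] at this
      rw [this, hy, map_sub, X.EA.fix _ hEA, sub_self, mul_zero, map_zero]
    · set c := X.tr.τ (e j * y * star (X.u γ)) with hcdef
      have hz : ∀ g, e j * X.u g ∈ X.M := fun g => mul_mem (h.memM j) (X.u_mem g)
      have horb : ∀ g ∈ {g : Γ | ∃ k : Γ, (∀ j, X.σ k (e j) = e j) ∧ g = k * γ * k⁻¹},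
          X.tr.τ (star (e j * X.u g) * y) = c := by
        rintro _ ⟨k, hk, rfl⟩
        have hkj := (X.σ_eq_iff k _).1 (hk j)
        have hkj' : star (X.u k) * e j = e j * star (X.u k) := by
          have := congrArg star hkj
          simp only [star_mul, h.st] at this
          exact this.symm
        rw [star_mul, h.st, mul_assoc, X.tr.tracial _ (star_mem (X.u_mem _)) _
          (mul_mem (h.memM j) hyM), ← X.u_mul, ← X.u_mul, ← X.u_star, star_mul, star_mul, star_star]
        calc X.tr.τ (e j * y * (X.u k * (star (X.u γ) * star (X.u k))))
            = X.tr.τ ((e j * y * X.u k * star (X.u γ)) * star (X.u k)) := by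
              congr 1
          _ = X.tr.τ (star (X.u k) * (e j * y * X.u k * star (X.u γ))) :=
              X.tr.tracial _ (mul_mem (mul_mem (mul_mem (h.memM j) hyM) (X.u_mem k))
                (star_mem (X.u_mem γ))) _ (star_mem (X.u_mem k))
          _ = X.tr.τ ((star (X.u k) * e j) * (y * X.u k) * star (X.u γ)) := by
              congr 1
          _ = X.tr.τ (e j * (star (X.u k) * X.u k) * y * star (X.u γ)) := by
              rw [hkj', ← hyc k hk]; congr 1
          _ = c := by rw [X.star_mul_u, mul_one]
      have hnp := h.n_pos
      have horth : ∀ g g', X.tr.τ (star (e j * X.u g) * (e j * X.u g')) =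
          if g = g' then (((n : ℝ)⁻¹ : ℝ) : ℂ) else 0 := by
        intro g g'
        rw [star_mul, h.st, X.u_star]
        have e1 : X.u g⁻¹ * e j * (e j * X.u g') = X.u g⁻¹ * ((e j * e j) * X.u g') := by
          noncomm_ring
        rw [e1, h.idem, X.tr.tracial _ (X.u_mem _) _ (hz g'), mul_assoc, X.u_mul]
        split_ifs with hgg
        · rw [hgg, mul_inv_cancel, X.u_one, mul_one, h.τ_e']
        · refine X.τ_a_u (h.mem j) ?_
          intro h1
          exact hgg (mul_inv_eq_one.1 h1).symm
      by_contra hc0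
      have hcpos : 0 < ‖c‖ ^ 2 := by have := norm_pos_iff.2 hc0; positivity
      obtain ⟨N, hN⟩ := exists_nat_gt ((n : ℝ)⁻¹ * (X.tr.τ (star y * y)).re / ‖c‖ ^ 2)
      obtain ⟨F, hF, hFc⟩ := (h.orbit_inf hγ).exists_subset_card_eq N
      have hb := bessel X.M X.tr (fun g => e j * X.u g) hz (inv_pos.2 hnp) horth hyM c F
        (fun g hg => horb g (hF hg))
      rw [hFc] at hb
      rw [div_lt_iff₀ hcpos] at hN
      linarith
  have : x = X.EA.E x := sub_eq_zero.1 hy0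
  rw [this]
  exact hEA

theorem A_Lg (h : Atoms X n e) {f : H →L[ℂ] H} (hA : f ∈ X.A) (hL : f ∈ X.Lg) :
    f = X.tr.τ f • (1 : H →L[ℂ] H) := by
  rw [← sub_eq_zero]
  have hone : (1 : H →L[ℂ] H) ∈ Submodule.span ℂ (Set.range X.u) :=
    Submodule.subset_span ⟨1, X.u_one⟩
  have hxL : f - X.tr.τ f • (1 : H →L[ℂ] H) ∈ X.Lg :=
    sub_mem hL (smul_mem' X.Lg _ (one_mem _))
  refine normal_zero X.M h.fac X.tr (Submodule.span ℂ (Set.range X.u)) hone ?_ ?_ ?_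
    (X.Lg_M hxL) ?_ ?_
  · intro y hy
    induction hy using Submodule.span_induction with
    | mem x hx => obtain ⟨γ, rfl⟩ := hx; exact X.u_mem γ
    | zero => exact zero_mem _
    | add x y _ _ hx hy => exact add_mem hx hy
    | smul c x _ hx => exact smul_mem' _ c hx
  · intro x hx y hy
    induction hx using Submodule.span_induction with
    | mem x hx =>
      obtain ⟨γ, rfl⟩ := hx
      induction hy using Submodule.span_induction with
      | mem y hy =>
        obtain ⟨δ, rfl⟩ := hy
        rw [X.u_mul]; exact Submodule.subset_span ⟨_, rfl⟩
      | zero => rw [mul_zero]; exact zero_mem _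
      | add x y _ _ hx hy => rw [mul_add]; exact add_mem hx hy
      | smul c x _ hx => rw [mul_smul_comm]; exact Submodule.smul_mem _ c hx
    | zero => rw [zero_mul]; exact zero_mem _
    | add x y _ _ hx hy => rw [add_mul]; exact add_mem hx hy
    | smul c x _ hx => rw [smul_mul_assoc]; exact Submodule.smul_mem _ c hx
  · intro y hy
    induction hy using Submodule.span_induction with
    | mem x hx =>
      obtain ⟨γ, rfl⟩ := hx; rw [X.u_star]; exact Submodule.subset_span ⟨_, rfl⟩
    | zero => rw [star_zero]; exact zero_mem _
    | add x y _ _ hx hy => rw [star_add]; exact add_mem hx hy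
    | smul c x _ hx => rw [star_smul]; exact Submodule.smul_mem _ _ hx
  · have h1 : f - X.tr.τ f • (1 : H →L[ℂ] H) ∈ (X.Lg : Set (H →L[ℂ] H)) := hxL
    rw [X.Lg_eq] at h1
    exact Set.centralizer_subset (Set.centralizer_subset Submodule.subset_span) h1
  · intro y hy
    induction hy using Submodule.span_induction with
    | mem x hx =>
      obtain ⟨γ, rfl⟩ := hx
      rw [X.tr.tracial _ (X.u_mem γ) _ (X.Lg_M hxL)]
      by_cases hγ : γ = 1
      · subst hγ
        rw [X.u_one, mul_one, map_sub, map_smul, X.tr.unital]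
        simp
      · exact X.τ_a_u (sub_mem hA (smul_mem' X.A _ (one_mem _))) hγ
    | zero => simp
    | add x y _ _ hx hy => rw [add_mul, map_add, hx, hy, add_zero]
    | smul c x _ hx => rw [smul_mul_assoc, map_smul, hx, smul_zero]

end Atoms

end Crossed

end CD

namespace CD

section StabChar

variable {H : Type} [NormedAddCommGroup H] [InnerProductSpace ℂ H] [CompleteSpace H]
variable {K : Type} [NormedAddCommGroup K] [InnerProductSpace ℂ K] [CompleteSpace K]
variable {Γ : Type} [Group Γ] {Λ : Type} [Group Λ]

theorem StarIsoOn.map_zero' {M : VonNeumannAlgebra H} {N : VonNeumannAlgebra K}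
    (θ : StarIsoOn (M : Set (H →L[ℂ] H)) (N : Set (K →L[ℂ] K))) : θ.Θ 0 = 0 := by
  have := θ.map_smul 0 1 (one_mem M)
  rw [zero_smul, zero_smul] at this
  exact this

theorem StarIsoOn.map_sum' {M : VonNeumannAlgebra H} {N : VonNeumannAlgebra K}
    (θ : StarIsoOn (M : Set (H →L[ℂ] H)) (N : Set (K →L[ℂ] K))) {ι : Type} (s : Finset ι)
    (f : ι → (H →L[ℂ] H)) (hf : ∀ i, f i ∈ M) :
    θ.Θ (∑ i ∈ s, f i) = ∑ i ∈ s, θ.Θ (f i) := by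
  induction s using Finset.induction_on with
  | empty => simp [θ.map_zero']
  | insert a s ha ih =>
    rw [Finset.sum_insert ha, Finset.sum_insert ha, θ.map_add _ (hf a) _ (sum_mem fun i _ => hf i), ih]

def StarIsoOn.idIso (M : VonNeumannAlgebra H) :
    StarIsoOn (M : Set (H →L[ℂ] H)) (M : Set (H →L[ℂ] H)) where
  Θ := id
  mem := fun _ hx => hx
  map_one := rfl
  map_add := fun _ _ _ _ => rfl
  map_smul := fun _ _ _ => rfl
  map_mul := fun _ _ _ _ => rfl
  map_star := fun _ _ => rfl
  inj := fun _ _ _ _ hxy => hxy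
  surj := fun y hy => ⟨y, hy, rfl⟩

namespace Atoms

variable {X : CrossedProduct Γ H} {n : ℕ} {e : Fin n → (H →L[ℂ] H)}

theorem E_theta (h : Atoms X n e) (Y : CrossedProduct Λ K)
    (θ : StarIsoOn (X.M : Set (H →L[ℂ] H)) (Y.M : Set (K →L[ℂ] K)))
    (hθL : θ.Θ '' (X.Lg : Set (H →L[ℂ] H)) = (Y.Lg : Set (K →L[ℂ] K))) (i : Fin n) :
    Y.EL.E (θ.Θ (e i)) = (n : ℂ)⁻¹ • (1 : K →L[ℂ] K) := by
  have hex : ∀ i, ∃ x ∈ X.Lg, θ.Θ x = Y.EL.E (θ.Θ (e i)) := by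
    intro i
    have : Y.EL.E (θ.Θ (e i)) ∈ (Y.Lg : Set (K →L[ℂ] K)) :=
      Y.EL.mem _ (θ.mem _ (h.memM i))
    obtain ⟨x, hx, hx'⟩ := hθL.ge this
    exact ⟨x, hx, hx'⟩
  choose x hxL hx using hex
  have hxM : ∀ i, x i ∈ X.M := fun i => X.Lg_M (hxL i)
  have huL : ∀ γ, θ.Θ (X.u γ) ∈ (Y.Lg : Set (K →L[ℂ] K)) := by
    intro γ
    rw [← hθL]
    exact ⟨_, X.u_Lg γ, rfl⟩
  have hθσ : ∀ γ y, y ∈ X.M → θ.Θ (X.σ γ y) = θ.Θ (X.u γ) * θ.Θ y * star (θ.Θ (X.u γ)) := by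
    intro γ y hy
    rw [CrossedProduct.σ, θ.map_mul _ (mul_mem (X.u_mem γ) hy) _ (star_mem (X.u_mem γ)),
      θ.map_mul _ (X.u_mem γ) _ hy, θ.map_star _ (X.u_mem γ)]
  have hcov : ∀ γ i j, X.σ γ (e i) = e j → X.σ γ (x i) = x j := by
    intro γ i j hij
    refine θ.inj _ (X.σ_memM γ (hxM i)) _ (hxM j) ?_
    have hst : star (θ.Θ (X.u γ)) ∈ (Y.Lg : Set (K →L[ℂ] K)) := star_mem (s := Y.Lg) (huL γ)
    rw [hθσ γ _ (hxM i), hx, hx, ← hij, hθσ γ _ (h.memM i),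
      Y.EL.bimod _ (huL γ) _ hst _ (θ.mem _ (h.memM i))]
  have hsc : ∀ i, x i = X.tr.τ (x i) • (1 : H →L[ℂ] H) := by
    intro i
    refine h.A_Lg (h.comm_in_A (hxM i) fun k hk => ?_) (hxL i)
    exact (X.σ_eq_iff k _).1 (hcov k i i (hk i))
  have heq : ∀ j, x j = x i := by
    intro j
    obtain ⟨γ, hγ⟩ := h.trans i j
    rw [← hcov γ i j hγ, hsc i, X.σ_smul, CrossedProduct.σ, mul_one, X.u_mul_star]
  have hsum : ∑ j, Y.EL.E (θ.Θ (e j)) = 1 := by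
    rw [← map_sum, ← θ.map_sum' _ _ h.memM, h.sum, θ.map_one, Y.EL.fix _ (one_mem Y.Lg)]
  simp only [← hx, heq] at hsum
  rw [Finset.sum_const, Finset.card_univ, Fintype.card_fin, ← Nat.cast_smul_eq_nsmul ℂ] at hsum
  rw [← hx, ← hsum, smul_smul, inv_mul_cancel₀ h.n_ne, one_smul]

theorem E_e (h : Atoms X n e) (i : Fin n) : X.EL.E (e i) = (n : ℂ)⁻¹ • (1 : H →L[ℂ] H) :=
  h.E_theta X (StarIsoOn.idIso X.M) (by simp [StarIsoOn.idIso]) i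

theorem E_mul_e (h : Atoms X n e) (i : Fin n) {y : H →L[ℂ] H} (hy : y ∈ X.Lg) :
    X.EL.E (y * e i) = (n : ℂ)⁻¹ • y := by
  have := X.EL.bimod y hy 1 (one_mem X.Lg) (e i) (h.memM i)
  rw [mul_one, mul_one] at this
  rw [this, h.E_e, mul_smul_comm, mul_one]

theorem exists_Q (h : Atoms X n e) (i : Fin n) {x : H →L[ℂ] H} (hx : x ∈ X.M) :
    ∃ y ∈ X.Lg, x * e i = y * e i := by
  have hxb : x * e i ∈ X.M := mul_mem hx (h.memM i)
  have hEL : X.EL.E (x * e i) ∈ X.Lg := X.EL.mem _ hxb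
  refine ⟨(n : ℂ) • X.EL.E (x * e i), smul_mem' X.Lg _ hEL, ?_⟩
  set y := (n : ℂ) • X.EL.E (x * e i) with hy
  have hyL : y ∈ X.Lg := smul_mem' X.Lg _ hEL
  rw [← sub_eq_zero]
  set z := x * e i - y * e i with hz
  have hzM : z ∈ X.M := sub_mem hxb (mul_mem (X.Lg_M hyL) (h.memM i))
  have hzb : z * e i = z := by
    rw [hz, sub_mul, mul_assoc, mul_assoc, h.idem]
  have hEz : X.EL.E z = 0 := by
    rw [hz, map_sub, h.E_mul_e i hyL, hy, smul_smul, inv_mul_cancel₀ h.n_ne, one_smul, sub_self]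
  refine h.sep hzM fun γ j => ?_
  have hs := star_mem (X.u_mem γ)
  have h1 : X.tr.τ (e j * z * star (X.u γ)) = X.tr.τ (z * (e i * (star (X.u γ) * e j))) := by
    rw [mul_assoc, X.tr.tracial _ (h.memM j) _ (mul_mem hzM hs)]
    nth_rw 1 [← hzb]
    simp only [mul_assoc]
  have h2 : star (X.u γ) * e j = X.σ γ⁻¹ (e j) * star (X.u γ) := by
    rw [X.u_star, X.u_mul']
  obtain ⟨k, hk⟩ := h.perm γ⁻¹ j
  rw [h1, h2, hk]
  by_cases hik : i = k
  · subst hik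
    rw [← mul_assoc (e i), h.idem, ← mul_assoc, hzb, ← X.EL.trace_eq _ (mul_mem hzM hs)]
    have := X.EL.bimod 1 (one_mem X.Lg) (star (X.u γ)) (star_mem (X.u_Lg γ)) z hzM
    rw [one_mul, hEz, one_mul, zero_mul] at this
    rw [this, map_zero]
  · rw [← mul_assoc (e i), h.orth i k hik, zero_mul, mul_zero, map_zero]

theorem cyc (h : Atoms X n e) (i : Fin n) {c : H →L[ℂ] H}
    (hc : ∀ s ∈ X.Lg.commutant, c * s * e i = 0) : c = 0 := by
  set V : Submodule ℂ H := Submodule.span ℂ {ζ | ∃ s ∈ X.Lg.commutant, ∃ ξ, ζ = s (e i ξ)} with hV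
  obtain ⟨P, hP, hPs, hPP, hP1, hP2⟩ := range_proj X.Lg V (by
    intro s hs ξ hξ
    induction hξ using Submodule.span_induction with
    | mem x hx =>
      obtain ⟨t, ht, ξ, rfl⟩ := hx
      exact Submodule.subset_span ⟨s * t, mul_mem hs ht, ξ, rfl⟩
    | zero => rw [_root_.map_zero]; exact zero_mem _
    | add x y _ _ hx hy => rw [_root_.map_add]; exact add_mem hx hy
    | smul c x _ hx => rw [_root_.map_smul]; exact Submodule.smul_mem _ c hx)
  have hPb : P * e i = e i := by
    ext ξ
    exact hP1 _ (Submodule.subset_span ⟨1, one_mem _, ξ, rfl⟩)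
  have hP' : P = 1 := by
    have h1 : X.EL.E (P * e i) = X.EL.E (e i) := by rw [hPb]
    rw [h.E_mul_e i hP, h.E_e] at h1
    exact smul_right_injective _ (inv_ne_zero h.n_ne) h1
  have := hP2 c (by
    intro ξ hξ
    induction hξ using Submodule.span_induction with
    | mem x hx =>
      obtain ⟨t, ht, ξ, rfl⟩ := hx
      exact DFunLike.congr_fun (hc t ht) ξ
    | zero => exact _root_.map_zero _
    | add x y _ _ hx hy => rw [_root_.map_add, hx, hy, add_zero]
    | smul c x _ hx => rw [_root_.map_smul, hx, smul_zero])
  rw [hP', mul_one] at this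
  exact this

theorem comm_T (h : Atoms X n e) (i : Fin n) {T x : H →L[ℂ] H}
    (hT : ∀ γ, X.σ γ (e i) = e i → X.u γ * T = T * X.u γ)
    (hTb : e i * T = T) (hTb' : T * e i = T) (hx : x ∈ X.Lg) (hxb : x * e i = e i * x) :
    x * T = T * x := by
  obtain ⟨π, hπ, hbij⟩ := h.exists_pi
  choose lam hlam using h.trans i
  have hσT : ∀ γ, X.σ γ (e i) = e i → X.σ γ T = T := fun γ hγ => (X.σ_eq_iff γ T).2 (hT γ hγ)
  set S := ∑ k, X.σ (lam k) T with hS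
  have hSσ : ∀ γ, X.σ γ S = S := by
    intro γ
    rw [hS, X.σ_sum]
    refine Finset.sum_bijective (π γ) (hbij γ) (by simp) ?_
    intro k _
    rw [X.σ_comp]
    have hfix : X.σ ((lam (π γ k))⁻¹ * (γ * lam k)) (e i) = e i := by
      rw [← X.σ_comp, ← X.σ_comp, hlam, hπ, ← hlam (π γ k), X.σ_inv]
    have := hσT _ hfix
    calc X.σ (γ * lam k) T = X.σ (lam (π γ k)) (X.σ ((lam (π γ k))⁻¹ * (γ * lam k)) T) := by
          rw [X.σ_comp]; congr 1; group
      _ = _ := by rw [this]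
  have hl : ∀ k, e k * X.σ (lam k) T = X.σ (lam k) T := by
    intro k
    rw [← hlam k, ← X.σ_mul, hTb]
  have hr : ∀ k, X.σ (lam k) T * e k = X.σ (lam k) T := by
    intro k
    conv_lhs => rw [← hlam k, ← X.σ_mul, hTb']
  have hii : X.σ (lam i) T = T := hσT _ (hlam i)
  have hbS : e i * S = T := by
    rw [hS, Finset.mul_sum, Finset.sum_eq_single i]
    · rw [hl, hii]
    · intro k _ hk
      rw [← hl k, ← mul_assoc, h.orth i k hk.symm, zero_mul]
    · simp
  have hSb : S * e i = T := by
    rw [hS, Finset.sum_mul, Finset.sum_eq_single i]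
    · rw [hr, hii]
    · intro k _ hk
      rw [← hr k, mul_assoc, h.orth k i hk, mul_zero]
    · simp
  have hxS := X.Lg_comm hx (fun γ => (X.σ_eq_iff γ S).1 (hSσ γ))
  calc x * T = x * e i * S := by rw [mul_assoc, hbS]
    _ = e i * (x * S) := by rw [hxb, mul_assoc]
    _ = e i * S * x := by rw [← hxS, mul_assoc]
    _ = T * x := by rw [hbS]

theorem stab_char (h : Atoms X n e) (i : Fin n) (x : H →L[ℂ] H) :
    x ∈ LStabSet X (e i) ↔ x ∈ X.Lg ∧ x * e i = e i * x := by
  constructor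
  · intro hx
    constructor
    · have : x ∈ (X.Lg : Set (H →L[ℂ] H)) := by
        rw [X.Lg_eq]
        exact Set.centralizer_subset (Set.centralizer_subset (Set.image_subset_range _ _)) hx
      exact this
    · refine (hx (e i) ?_).symm
      rintro _ ⟨γ, hγ, rfl⟩
      exact (X.σ_eq_iff γ _).1 hγ
  · rintro ⟨hx, hxb⟩
    intro r hr
    have hr' : ∀ γ, X.σ γ (e i) = e i → X.u γ * r = r * X.u γ := fun γ hγ => hr _ ⟨γ, hγ, rfl⟩
    rw [← sub_eq_zero]
    refine h.cyc i fun s hs => ?_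
    rw [← star_eq_zero]
    refine h.cyc i fun t ht => ?_
    rw [← star_eq_zero]
    have hts : star t ∈ X.Lg.commutant := star_mem ht
    have hus : ∀ γ, s * X.u γ = X.u γ * s := fun γ => comm_of_mem X.Lg (X.u_Lg γ) hs
    have hut : ∀ γ, star t * X.u γ = X.u γ * star t := fun γ => comm_of_mem X.Lg (X.u_Lg γ) hts
    have hxs : s * x = x * s := comm_of_mem X.Lg hx hs
    have hxt : star t * x = x * star t := comm_of_mem X.Lg hx hts
    have key := h.comm_T i (T := e i * (star t * r * s) * e i) (x := x) (by
        intro γ hγ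
        have hb := (X.σ_eq_iff γ _).1 hγ
        calc X.u γ * (e i * (star t * r * s) * e i)
            = (X.u γ * e i) * star t * r * s * e i := by noncomm_ring
          _ = e i * (X.u γ * star t) * r * s * e i := by rw [hb]; noncomm_ring
          _ = e i * star t * (X.u γ * r) * s * e i := by rw [← hut]; noncomm_ring
          _ = e i * star t * r * (X.u γ * s) * e i := by rw [hr' γ hγ]; noncomm_ring
          _ = e i * star t * r * s * (X.u γ * e i) := by rw [← hus]; noncomm_ring
          _ = _ := by rw [hb]; noncomm_ring)
      (by rw [← mul_assoc, ← mul_assoc, h.idem]) (by rw [mul_assoc, h.idem]) hx hxb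
    have e1 : x * (e i * (star t * r * s) * e i) = e i * star t * (x * r) * s * e i := by
      calc x * (e i * (star t * r * s) * e i) = (x * e i) * star t * r * s * e i := by noncomm_ring
        _ = e i * (x * star t) * r * s * e i := by rw [hxb]; noncomm_ring
        _ = _ := by rw [← hxt]; noncomm_ring
    have e2 : (e i * (star t * r * s) * e i) * x = e i * star t * (r * x) * s * e i := by
      calc (e i * (star t * r * s) * e i) * x = e i * star t * r * s * (e i * x) := by noncomm_ring
        _ = e i * star t * r * (s * x) * e i := by rw [← hxb]; noncomm_ring
        _ = _ := by rw [hxs]; noncomm_ring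
    rw [e1, e2] at key
    simp only [star_mul, star_star, h.st]
    calc e i * (star t * ((r * x - x * r) * s * e i))
        = e i * star t * (r * x) * s * e i - e i * star t * (x * r) * s * e i := by noncomm_ring
      _ = 0 := by rw [key, sub_self]

end Atoms

end StabChar

end CD

namespace CD

section Jones

variable {H : Type} [NormedAddCommGroup H] [InnerProductSpace ℂ H] [CompleteSpace H]
variable {K : Type} [NormedAddCommGroup K] [InnerProductSpace ℂ K] [CompleteSpace K]
variable {Γ : Type} [Group Γ] {Λ : Type} [Group Λ]

theorem jones_half (Y : CrossedProduct Λ K) {p q v : K →L[ℂ] K} {c d : ℂ}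
    (hq : q ∈ Y.M) (hqs : star q = q) (hqq : q * q = q)
    (hQ : ∀ x ∈ Y.M, ∃ y ∈ Y.Lg, x * q = y * q)
    (hEp : Y.EL.E p = c • (1 : K →L[ℂ] K)) (hEq : Y.EL.E q = d • (1 : K →L[ℂ] K))
    (hc : c ≠ 0) (hd : d ≠ 0) (hv : v ∈ Y.M) (hvq : v * q = v) (hvv : v * star v = p)
    (hpv : p * v = v) :
    c = d ∧ ∃ w, IsUnitaryIn (Y.Lg : Set (K →L[ℂ] K)) w ∧ p = w * q * star w := by
  obtain ⟨y, hy, hyq⟩ := hQ v hv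
  rw [hvq] at hyq
  have hyM := Y.Lg_M hy
  have hys : star y ∈ Y.Lg := star_mem hy
  have hysM := Y.Lg_M hys
  have hp : p = y * q * star y := by
    rw [← hvv, hyq, star_mul, hqs]
    calc y * q * (q * star y) = y * (q * q) * star y := by noncomm_ring
      _ = _ := by rw [hqq]
  have hyy : y * star y = (c / d) • (1 : K →L[ℂ] K) := by
    have := Y.EL.bimod y hy _ hys q hq
    rw [← hp, hEp, hEq, mul_smul_comm, mul_one, smul_mul_assoc] at this
    rw [div_eq_inv_mul, ← smul_smul, this, smul_smul, inv_mul_cancel₀ hd, one_smul]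
  set k := c / d with hk
  have hk0 : k ≠ 0 := div_ne_zero hc hd
  have hone : (1 : K →L[ℂ] K) ≠ 0 := by
    intro h1
    have := Y.tr.unital
    rw [h1, map_zero] at this
    exact zero_ne_one this
  have hkc : (starRingEnd ℂ) k = k := by
    have := congrArg star hyy
    rw [star_mul, star_star, hyy, star_smul, star_one] at this
    exact (smul_left_injective ℂ hone this).symm
  have hN : star y * y = k • (1 : K →L[ℂ] K) := by
    rw [← sub_eq_zero]
    refine Y.tr.faithful _ (sub_mem (mul_mem hysM hyM) (smul_mem' Y.M _ (one_mem _))) ?_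
    have e1 : star (star y * y - k • (1 : K →L[ℂ] K)) * (star y * y - k • (1 : K →L[ℂ] K))
        = star y * (y * star y) * y - k • (star y * y) - k • (star y * y)
          + (k * k) • (1 : K →L[ℂ] K) := by
      rw [star_sub, star_mul, star_star, star_smul, star_one]
      change (star y * y - (starRingEnd ℂ k) • (1 : K →L[ℂ] K)) * _ = _
      rw [hkc, sub_mul, mul_sub, mul_sub, mul_smul_comm, mul_one, smul_mul_assoc, one_mul,
        smul_mul_smul_comm, one_mul]
      simp only [mul_assoc]
      abel
    have e2 : Y.tr.τ (star y * y) = k := by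
      rw [Y.tr.tracial _ hysM _ hyM, hyy, map_smul, Y.tr.unital, smul_eq_mul, mul_one]
    rw [e1, hyy, mul_smul_comm, mul_one, smul_mul_assoc]
    simp only [map_add, map_sub, map_smul, smul_eq_mul, e2, Y.tr.unital]
    ring
  have hq0 : q ≠ 0 := by
    rintro rfl
    rw [map_zero] at hEq
    exact (smul_ne_zero hd hone) hEq.symm
  have hvsv : star v * v = k • q := by
    rw [hyq, star_mul, hqs]
    calc q * star y * (y * q) = q * (star y * y) * q := by noncomm_ring
      _ = _ := by rw [hN, mul_smul_comm, mul_one, smul_mul_assoc, hqq]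
  have hidem : star v * v * (star v * v) = star v * v := by
    calc star v * v * (star v * v) = star v * ((v * star v) * v) := by noncomm_ring
      _ = _ := by rw [hvv, hpv]
  rw [hvsv, smul_mul_smul_comm, hqq] at hidem
  have hkk : k * k = k := smul_left_injective ℂ hq0 hidem
  have hk1 : k = 1 := mul_left_cancel₀ hk0 (by rw [hkk, mul_one])
  rw [hk1, one_smul] at hyy hN
  refine ⟨?_, y, ⟨hy, hN, hyy⟩, hp⟩
  rw [hk, div_eq_one_iff_eq hd] at hk1
  exact hk1

theorem jones (Y : CrossedProduct Λ K) (hf : IsFactorSet (Y.M : Set (K →L[ℂ] K)))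
    {p q : K →L[ℂ] K} {c d : ℂ}
    (hp : p ∈ Y.M) (hps : star p = p) (hpp : p * p = p)
    (hq : q ∈ Y.M) (hqs : star q = q) (hqq : q * q = q)
    (hP : ∀ x ∈ Y.M, ∃ y ∈ Y.Lg, x * p = y * p)
    (hQ : ∀ x ∈ Y.M, ∃ y ∈ Y.Lg, x * q = y * q)
    (hEp : Y.EL.E p = c • (1 : K →L[ℂ] K)) (hEq : Y.EL.E q = d • (1 : K →L[ℂ] K))
    (hc : c ≠ 0) (hd : d ≠ 0) :
    c = d ∧ ∃ w, IsUnitaryIn (Y.Lg : Set (K →L[ℂ] K)) w ∧ p = w * q * star w := by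
  obtain ⟨v, hv, hvvv, hpv, hvq, h1 | h1⟩ := comparison Y.M hf hp hps hpp hq hqs hqq
  · exact jones_half Y hq hqs hqq hQ hEp hEq hc hd hv hvq h1 hpv
  · have a1 : star v * p = star v := by
      have := congrArg star hpv
      rwa [star_mul, hps] at this
    have a2 : q * star v = star v := by
      have := congrArg star hvq
      rwa [star_mul, hqs] at this
    obtain ⟨hcd, w, ⟨hw, hw1, hw2⟩, hqw⟩ := jones_half Y hp hps hpp hP hEq hEp hd hc
      (star_mem hv) a1 (by rw [star_star]; exact h1) a2
    refine ⟨hcd.symm, star w, ⟨star_mem (s := Y.Lg) hw, by rw [star_star]; exact hw2,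
      by rw [star_star]; exact hw1⟩, ?_⟩
    rw [star_star, hqw]
    calc p = 1 * p * 1 := by rw [one_mul, mul_one]
      _ = (star w * w) * p * (star w * w) := by rw [hw1]
      _ = _ := by noncomm_ring

variable {X : CrossedProduct Γ H} {n : ℕ} {e : Fin n → (H →L[ℂ] H)}
variable {Y : CrossedProduct Λ K} {m : ℕ} {f : Fin m → (K →L[ℂ] K)}

theorem main_conj (h : Atoms X n e) (h' : Atoms Y m f)
    (θ : StarIsoOn (X.M : Set (H →L[ℂ] H)) (Y.M : Set (K →L[ℂ] K)))
    (hθL : θ.Θ '' (X.Lg : Set (H →L[ℂ] H)) = (Y.Lg : Set (K →L[ℂ] K))) (i : Fin n) (j : Fin m) :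
    n = m ∧ ∃ w, IsUnitaryIn (Y.Lg : Set (K →L[ℂ] K)) w ∧ θ.Θ (e i) = w * f j * star w := by
  obtain ⟨h1, h2⟩ := jones Y h'.fac (p := θ.Θ (e i)) (q := f j) (θ.mem _ (h.memM i))
    (by rw [← θ.map_star _ (h.memM i), h.st])
    (by rw [← θ.map_mul _ (h.memM i) _ (h.memM i), h.idem]) (h'.memM j) (h'.st j) (h'.idem j)
    (by
      intro x hx
      obtain ⟨x', hx', rfl⟩ := θ.surj x hx
      obtain ⟨y, hy, hxy⟩ := h.exists_Q i hx'
      refine ⟨θ.Θ y, hθL.le ⟨y, hy, rfl⟩, ?_⟩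
      rw [← θ.map_mul _ hx' _ (h.memM i), ← θ.map_mul _ (X.Lg_M hy) _ (h.memM i), hxy])
    (fun x hx => h'.exists_Q j hx) (h.E_theta Y θ hθL i) (h'.E_e j)
    (inv_ne_zero h.n_ne) (inv_ne_zero h'.n_ne)
  refine ⟨?_, h2⟩
  exact_mod_cast inv_injective h1

theorem theta_LStab (h : Atoms X n e) (h' : Atoms Y m f)
    (θ : StarIsoOn (X.M : Set (H →L[ℂ] H)) (Y.M : Set (K →L[ℂ] K)))
    (hθL : θ.Θ '' (X.Lg : Set (H →L[ℂ] H)) = (Y.Lg : Set (K →L[ℂ] K))) (i : Fin n) (j : Fin m)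
    {w : K →L[ℂ] K} (hw : IsUnitaryIn (Y.Lg : Set (K →L[ℂ] K)) w)
    (hθ : θ.Θ (e i) = w * f j * star w) :
    θ.Θ '' LStabSet X (e i) = (fun y => w * y * star w) '' LStabSet Y (f j) := by
  obtain ⟨hwL, hw1, hw2⟩ := hw
  have hwL : w ∈ Y.Lg := hwL
  ext y
  constructor
  · rintro ⟨x, hx, rfl⟩
    obtain ⟨hxL, hxc⟩ := (h.stab_char i x).1 hx
    have hy : θ.Θ x ∈ Y.Lg := hθL.le ⟨x, hxL, rfl⟩
    have hyc : θ.Θ x * θ.Θ (e i) = θ.Θ (e i) * θ.Θ x := by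
      rw [← θ.map_mul _ (X.Lg_M hxL) _ (h.memM i), ← θ.map_mul _ (h.memM i) _ (X.Lg_M hxL), hxc]
    refine ⟨star w * θ.Θ x * w, (h'.stab_char j _).2
      ⟨mul_mem (mul_mem (star_mem hwL) hy) hwL, ?_⟩, ?_⟩
    · rw [hθ] at hyc
      calc star w * θ.Θ x * w * f j
          = star w * (θ.Θ x * (w * f j * (star w * w))) := by rw [hw1]; noncomm_ring
        _ = star w * (θ.Θ x * (w * f j * star w)) * w := by noncomm_ring
        _ = (star w * w) * f j * star w * θ.Θ x * w := by rw [hyc]; noncomm_ring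
        _ = _ := by rw [hw1]; noncomm_ring
    · change w * (star w * θ.Θ x * w) * star w = _
      calc w * (star w * θ.Θ x * w) * star w = (w * star w) * θ.Θ x * (w * star w) := by
            noncomm_ring
        _ = _ := by rw [hw2, one_mul, mul_one]
  · rintro ⟨z, hz, rfl⟩
    obtain ⟨hzL, hzc⟩ := (h'.stab_char j z).1 hz
    have : w * z * star w ∈ Y.Lg := mul_mem (mul_mem hwL hzL) (star_mem hwL)
    obtain ⟨x, hx, hxz⟩ := hθL.ge this
    have hx : x ∈ X.Lg := hx
    refine ⟨x, (h.stab_char i x).2 ⟨hx, ?_⟩, hxz⟩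
    refine θ.inj _ (mul_mem (X.Lg_M hx) (h.memM i)) _ (mul_mem (h.memM i) (X.Lg_M hx)) ?_
    rw [θ.map_mul _ (X.Lg_M hx) _ (h.memM i), θ.map_mul _ (h.memM i) _ (X.Lg_M hx), hxz, hθ]
    calc w * z * star w * (w * f j * star w) = w * z * (star w * w) * f j * star w := by
          noncomm_ring
      _ = w * (z * f j) * star w := by rw [hw1]; noncomm_ring
      _ = w * f j * 1 * z * star w := by rw [hzc]; noncomm_ring
      _ = _ := by rw [← hw1]; noncomm_ring

end Jones

end CD

namespace CD

section Part3

variable {H : Type} [NormedAddCommGroup H] [InnerProductSpace ℂ H] [CompleteSpace H]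
variable {K : Type} [NormedAddCommGroup K] [InnerProductSpace ℂ K] [CompleteSpace K]
variable {Γ : Type} [Group Γ] {Λ : Type} [Group Λ]

theorem linInd_of_orth {n : ℕ} {p : Fin n → (K →L[ℂ] K)} (hidem : ∀ i, p i * p i = p i)
    (hne : ∀ i, p i ≠ 0) (horth : ∀ i j, i ≠ j → p i * p j = 0) : LinearIndependent ℂ p := by
  rw [Fintype.linearIndependent_iff]
  intro c hc j
  have : p j * ∑ i, c i • p i = c j • p j := by
    rw [Finset.mul_sum, Finset.sum_eq_single j]
    · rw [mul_smul_comm, hidem]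
    · intro i _ hi
      rw [mul_smul_comm, horth j i (Ne.symm hi), smul_zero]
    · simp
  rw [hc, mul_zero] at this
  exact (smul_eq_zero.1 this.symm).resolve_right (hne j)

/-- Conjugating a `*`-isomorphism by a unitary. -/
def StarIsoOn.conj {M : VonNeumannAlgebra H} {N : VonNeumannAlgebra K}
    (θ : StarIsoOn (M : Set (H →L[ℂ] H)) (N : Set (K →L[ℂ] K))) (w : K →L[ℂ] K)
    (hw : w ∈ N) (hw1 : star w * w = 1) (hw2 : w * star w = 1) :
    StarIsoOn (M : Set (H →L[ℂ] H)) (N : Set (K →L[ℂ] K)) where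
  Θ := fun x => star w * θ.Θ x * w
  mem := fun x hx => mul_mem (s := N) (mul_mem (star_mem hw) (θ.mem x hx)) hw
  map_one := by rw [θ.map_one, mul_one, hw1]
  map_add := fun x hx y hy => by rw [θ.map_add x hx y hy, mul_add, add_mul]
  map_smul := fun c x hx => by rw [θ.map_smul c x hx, mul_smul_comm, smul_mul_assoc]
  map_mul := fun x hx y hy => by
    rw [θ.map_mul x hx y hy]
    calc star w * (θ.Θ x * θ.Θ y) * w = star w * θ.Θ x * 1 * θ.Θ y * w := by noncomm_ring
      _ = _ := by rw [← hw2]; noncomm_ring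
  map_star := fun x hx => by
    rw [θ.map_star x hx]; simp only [star_mul, star_star, mul_assoc]
  inj := fun x hx y hy hxy => by
    refine θ.inj x hx y hy ?_
    have hz : ∀ z : K →L[ℂ] K, z = w * (star w * z * w) * star w := by
      intro z
      calc z = 1 * z * 1 := by rw [one_mul, mul_one]
        _ = (w * star w) * z * (w * star w) := by rw [hw2]
        _ = _ := by noncomm_ring
    rw [hz (θ.Θ x), hxy, ← hz]
  surj := fun y hy => by
    obtain ⟨x, hx, hxy⟩ := θ.surj (w * y * star w)
      (mul_mem (s := N) (mul_mem hw hy) (star_mem hw))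
    refine ⟨x, hx, ?_⟩
    rw [hxy]
    calc star w * (w * y * star w) * w = (star w * w) * y * (star w * w) := by noncomm_ring
      _ = y := by rw [hw1, one_mul, mul_one]

variable {X : CrossedProduct Γ H} {n : ℕ} {e : Fin n → (H →L[ℂ] H)}
variable {Y : CrossedProduct Λ K} {f : Fin n → (K →L[ℂ] K)}

theorem exists_lam (h' : Atoms Y n f) {g : K →L[ℂ] K} (hg : g ∈ Y.Lg) (hg0 : g ≠ 0) :
    ∃ lam : Λ, ∀ y ∈ Y.A, ∀ y' ∈ Y.A, y' * g = g * y → y' = Y.σ lam y := by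
  have hgM := Y.Lg_M hg
  obtain ⟨lam, hlam⟩ : ∃ lam, Y.EA.E (g * star (Y.u lam)) ≠ 0 := by
    by_contra hcon
    push Not at hcon
    exact hg0 (Y.fourier_sep g hgM hcon)
  refine ⟨lam, ?_⟩
  have hgu : g * star (Y.u lam) ∈ Y.Lg := mul_mem hg (star_mem (Y.u_Lg lam))
  have hguM := Y.Lg_M hgu
  set s := Y.tr.τ (g * star (Y.u lam)) with hs
  have hsc : Y.EA.E (g * star (Y.u lam)) = s • (1 : K →L[ℂ] K) := by
    rw [← sub_eq_zero]
    have h1 : Y.EA.E (s • (1 : K →L[ℂ] K)) = s • (1 : K →L[ℂ] K) :=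
      Y.EA.fix _ (smul_mem' Y.A s (one_mem _))
    rw [← h1, ← map_sub]
    refine h'.EA_zero (sub_mem hguM (smul_mem' Y.M s (one_mem _))) fun j => ?_
    rw [mul_sub, map_sub, Y.tr.tracial _ (h'.memM j) _ hguM,
      ← Y.EL.trace_eq _ (mul_mem hguM (h'.memM j)), h'.E_mul_e j hgu, mul_smul_comm, mul_one,
      map_smul, map_smul, h'.τ_e' j, ← hs]
    push_cast
    simp only [smul_eq_mul]
    ring
  have hs0 : s ≠ 0 := by
    intro h0
    rw [hsc, h0, zero_smul] at hlam
    exact hlam rfl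
  intro y hy y' hy' hyy
  have hσ : Y.σ lam y ∈ Y.A := Y.conj_mem lam y hy
  have e1 := Y.EA.bimod y' hy' 1 (one_mem Y.A) _ hguM
  have e2 := Y.EA.bimod 1 (one_mem Y.A) _ hσ _ hguM
  have e3 : y' * (g * star (Y.u lam)) * 1 = 1 * (g * star (Y.u lam)) * Y.σ lam y := by
    rw [mul_one, one_mul, ← mul_assoc, hyy, CrossedProduct.σ]
    calc g * y * star (Y.u lam) = g * 1 * y * star (Y.u lam) := by rw [mul_one]
      _ = _ := by rw [← Y.star_mul_u lam]; noncomm_ring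
  rw [e3, e2, hsc, mul_one, one_mul, mul_smul_comm, mul_one, smul_mul_assoc, one_mul] at e1
  exact (smul_right_injective _ hs0 e1).symm

theorem part3 (h : Atoms X n e) (h' : Atoms Y n f)
    (θ : StarIsoOn (X.M : Set (H →L[ℂ] H)) (Y.M : Set (K →L[ℂ] K)))
    (hθL : θ.Θ '' (X.Lg : Set (H →L[ℂ] H)) = (Y.Lg : Set (K →L[ℂ] K))) (i j : Fin n)
    (hij : θ.Θ (e i) = f j)
    (hnorm : ∀ g γ : Γ, X.σ γ (e i) = e i → X.σ (g * γ * g⁻¹) (e i) = e i) :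
    (∀ g lam : Λ, Y.σ lam (f j) = f j → Y.σ (g * lam * g⁻¹) (f j) = f j) ∧
    (∃ (G : Type) (_ : Group G) (φ : Γ →* G) (ψ : Λ →* G),
      Function.Surjective φ ∧ Function.Surjective ψ ∧
      (∀ γ : Γ, φ γ = 1 ↔ X.σ γ (e i) = e i) ∧
      (∀ lam : Λ, ψ lam = 1 ↔ Y.σ lam (f j) = f j)) := by
  -- the stabilizer acts trivially on `A`
  have htriv : ∀ γ, X.σ γ (e i) = e i → ∀ k, X.σ γ (e k) = e k := by
    intro γ hγ k
    obtain ⟨g, hg⟩ := h.trans i k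
    have := hnorm g⁻¹ γ hγ
    rw [← hg, X.σ_comp, show γ * g = g * (g⁻¹ * γ * g⁻¹⁻¹) by group, ← X.σ_comp, this]
  have hstab := theta_LStab h h' θ hθL i j (w := 1)
    ⟨one_mem Y.Lg, by simp, by simp⟩ (by simpa using hij)
  simp only [one_mul, star_one, mul_one, Set.image_id'] at hstab
  -- `θ(A)` commutes with `u_h` for `h` in the stabilizer of `b`
  have hcomm : ∀ lam, Y.σ lam (f j) = f j → ∀ a ∈ X.A, Y.u lam * θ.Θ a = θ.Θ a * Y.u lam := by
    intro lam hlam a ha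
    have hu : Y.u lam ∈ LStabSet Y (f j) :=
      (h'.stab_char j _).2 ⟨Y.u_Lg lam, (Y.σ_eq_iff lam _).1 hlam⟩
    obtain ⟨x, hx, hxu⟩ := hstab.ge hu
    have hxM : x ∈ X.M := X.Lg_M ((h.stab_char i x).1 hx).1
    have hxa : a * x = x * a := by
      refine hx a ?_
      rintro _ ⟨γ, hγ, rfl⟩
      exact (X.σ_eq_iff γ _).1 (h.σ_fix (htriv γ hγ) ha)
    rw [← hxu, ← θ.map_mul _ hxM _ (X.A_M ha), ← θ.map_mul _ (X.A_M ha) _ hxM, hxa]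
  have hAB : ∀ a ∈ X.A, θ.Θ a ∈ Y.A := by
    intro a ha
    exact h'.comm_in_A (θ.mem _ (X.A_M ha)) fun k hk => hcomm k (hk j) a ha
  have hpi : ∀ k, θ.Θ (e k) * θ.Θ (e k) = θ.Θ (e k) := by
    intro k
    rw [← θ.map_mul _ (h.memM k) _ (h.memM k), h.idem]
  have hpo : ∀ k l, k ≠ l → θ.Θ (e k) * θ.Θ (e l) = 0 := by
    intro k l hkl
    rw [← θ.map_mul _ (h.memM k) _ (h.memM l), h.orth k l hkl, θ.map_zero']
  have hpn : ∀ k, θ.Θ (e k) ≠ 0 := by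
    intro k hk
    refine h.ne k (θ.inj _ (h.memM k) _ (zero_mem X.M) ?_)
    rw [hk, θ.map_zero']
  have hsp : Submodule.span ℂ (Set.range fun k => θ.Θ (e k)) = Submodule.span ℂ (Set.range f) := by
    haveI : FiniteDimensional ℂ (Submodule.span ℂ (Set.range f)) :=
      FiniteDimensional.span_of_finite ℂ (Set.finite_range f)
    refine Submodule.eq_of_le_of_finrank_eq ?_ ?_
    · rw [Submodule.span_le]
      rintro _ ⟨k, rfl⟩
      obtain ⟨c, hc⟩ := h'.span _ (hAB _ (h.mem k))
      change θ.Θ (e k) ∈ Submodule.span ℂ (Set.range f)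
      rw [hc]
      exact sum_mem fun l _ => Submodule.smul_mem _ _ (Submodule.subset_span ⟨l, rfl⟩)
    · rw [finrank_span_eq_card (linInd_of_orth hpi hpn hpo),
        finrank_span_eq_card (linInd_of_orth h'.idem h'.ne h'.orth)]
  have hf : ∀ l, ∃ c : Fin n → ℂ, f l = ∑ k, c k • θ.Θ (e k) := by
    intro l
    have : f l ∈ Submodule.span ℂ (Set.range fun k => θ.Θ (e k)) := by
      rw [hsp]; exact Submodule.subset_span ⟨l, rfl⟩
    obtain ⟨c, hc⟩ := (Submodule.mem_span_range_iff_exists_fun ℂ).1 this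
    exact ⟨c, hc.symm⟩
  have htrivB : ∀ lam, Y.σ lam (f j) = f j → ∀ l, Y.σ lam (f l) = f l := by
    intro lam hlam l
    obtain ⟨c, hc⟩ := hf l
    rw [hc, Y.σ_sum]
    refine Finset.sum_congr rfl fun k _ => ?_
    rw [Y.σ_smul, (Y.σ_eq_iff lam _).2 (hcomm lam hlam _ (h.mem k))]
  have hnormB : ∀ g lam : Λ, Y.σ lam (f j) = f j → Y.σ (g * lam * g⁻¹) (f j) = f j := by
    intro g lam hlam
    obtain ⟨l, hl⟩ := h'.perm g⁻¹ j
    rw [← Y.σ_comp, ← Y.σ_comp, hl, htrivB lam hlam l, ← hl, Y.σ_inv']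
  -- every atom of `B` is the image of an atom of `A`
  have hatom : ∀ l, ∃ k, θ.Θ (e k) = f l := by
    intro l
    obtain ⟨c, hc⟩ := hf l
    obtain ⟨k, hk⟩ : ∃ k, c k ≠ 0 := by
      by_contra hcon
      push Not at hcon
      exact h'.ne l (by rw [hc]; simp [hcon])
    have h1 : θ.Θ (e k) * f l = c k • θ.Θ (e k) := by
      rw [hc, Finset.mul_sum, Finset.sum_eq_single k]
      · rw [mul_smul_comm, hpi]
      · intro k' _ hk'
        rw [mul_smul_comm, hpo k k' (Ne.symm hk'), smul_zero]
      · simp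
    obtain ⟨d, hd⟩ := h'.span _ (hAB _ (h.mem k))
    have h2 : θ.Θ (e k) * f l = d l • f l := by
      rw [hd]; exact h'.span_mul l d
    have h3 : θ.Θ (e k) = ((c k)⁻¹ * d l) • f l := by
      rw [← smul_smul, ← h2, h1, smul_smul, inv_mul_cancel₀ hk, one_smul]
    set t := (c k)⁻¹ * d l
    have ht0 : t ≠ 0 := by
      intro h0
      rw [h0, zero_smul] at h3
      exact hpn k h3
    have h4 := hpi k
    rw [h3, smul_mul_smul_comm, h'.idem] at h4
    have h5 : t * t = t := smul_left_injective ℂ (h'.ne l) h4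
    have h6 : t = 1 := mul_left_cancel₀ ht0 (by rw [h5, mul_one])
    exact ⟨k, by rw [h3, h6, one_smul]⟩
  -- the correspondence between `Γ` and `Λ`
  have hR : ∀ γ : Γ, ∃ lam : Λ, ∀ x ∈ X.A, θ.Θ (X.σ γ x) = Y.σ lam (θ.Θ x) := by
    intro γ
    have hu : θ.Θ (X.u γ) ∈ Y.Lg := hθL.le ⟨_, X.u_Lg γ, rfl⟩
    have hu0 : θ.Θ (X.u γ) ≠ 0 := by
      intro h0
      have h1 : X.u γ = 0 :=
        θ.inj _ (X.u_mem γ) _ (zero_mem X.M) (by rw [h0, θ.map_zero'])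
      have h2 := X.u_mul_star γ
      rw [h1, zero_mul] at h2
      have h3 := X.tr.unital
      rw [← h2, map_zero] at h3
      exact zero_ne_one h3
    obtain ⟨lam, hlam⟩ := exists_lam h' hu hu0
    refine ⟨lam, fun x hx => hlam _ (hAB x hx) _ (hAB _ (X.conj_mem γ x hx)) ?_⟩
    change θ.Θ (X.σ γ x) * θ.Θ (X.u γ) = _
    rw [← θ.map_mul _ (X.σ_memM γ (X.A_M hx)) _ (X.u_mem γ),
      ← θ.map_mul _ (X.u_mem γ) _ (X.A_M hx), X.u_mul']
  choose L hL using hR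
  refine ⟨hnormB, ?_⟩
  let N : Subgroup Λ :=
    { carrier := {lam | Y.σ lam (f j) = f j}
      mul_mem' := by
        intro a b ha hb
        change Y.σ (a * b) (f j) = f j
        rw [← Y.σ_comp, hb, ha]
      one_mem' := Y.σ_one _
      inv_mem' := by
        intro a ha
        change Y.σ a⁻¹ (f j) = f j
        have ha : Y.σ a (f j) = f j := ha
        conv_lhs => rw [← ha]
        exact Y.σ_inv a _ }
  have hN : ∀ lam, lam ∈ N ↔ Y.σ lam (f j) = f j := fun _ => Iff.rfl
  haveI : N.Normal := ⟨fun lam hlam g => hnormB g lam hlam⟩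
  have hmk : ∀ a b : Λ, ((a : Λ ⧸ N) = b) ↔ Y.σ a (f j) = Y.σ b (f j) := by
    intro a b
    rw [QuotientGroup.eq, hN, ← Y.σ_comp]
    constructor
    · intro hab
      rw [← hab, Y.σ_inv', hab]
    · intro hab
      rw [← hab, Y.σ_inv]
  have hLe : ∀ γ, Y.σ (L γ) (f j) = θ.Θ (X.σ γ (e i)) := by
    intro γ
    rw [hL γ _ (h.mem i), hij]
  let φ : Γ →* Λ ⧸ N := MonoidHom.mk' (fun γ => (L γ : Λ ⧸ N)) (by
    intro a b
    rw [← QuotientGroup.mk_mul, hmk, hLe, ← X.σ_comp, hL a (X.σ b (e i)) (X.conj_mem b _ (h.mem i)),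
      ← Y.σ_comp, hLe])
  have hφ : ∀ γ, φ γ = (L γ : Λ ⧸ N) := fun _ => rfl
  refine ⟨Λ ⧸ N, inferInstance, φ, QuotientGroup.mk' N, ?_, QuotientGroup.mk'_surjective N, ?_, ?_⟩
  · intro q
    obtain ⟨lam, rfl⟩ := QuotientGroup.mk_surjective q
    obtain ⟨l, hl⟩ := h'.perm lam j
    obtain ⟨k, hk⟩ := hatom l
    obtain ⟨γ, hγ⟩ := h.trans i k
    refine ⟨γ, ?_⟩
    rw [hφ, hmk, hLe, hγ, hk, hl]
  · intro γ
    rw [hφ, ← QuotientGroup.mk_one, hmk, hLe, Y.σ_one, ← hij]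
    constructor
    · exact fun hh => θ.inj _ (X.σ_memM γ (h.memM i)) _ (h.memM i) hh
    · intro hh
      rw [hh]
  · intro lam
    rw [QuotientGroup.mk'_apply, QuotientGroup.eq_one_iff, hN]

theorem conj_Lg {X : CrossedProduct Γ H} {Y : CrossedProduct Λ K}
    (θ : StarIsoOn (X.M : Set (H →L[ℂ] H)) (Y.M : Set (K →L[ℂ] K)))
    (hθL : θ.Θ '' (X.Lg : Set (H →L[ℂ] H)) = (Y.Lg : Set (K →L[ℂ] K)))
    {w : K →L[ℂ] K} (hw : w ∈ Y.Lg) (hw1 : star w * w = 1) (hw2 : w * star w = 1) :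
    (θ.conj w (Y.Lg_M hw) hw1 hw2).Θ '' (X.Lg : Set (H →L[ℂ] H)) = (Y.Lg : Set (K →L[ℂ] K)) := by
  ext y
  constructor
  · rintro ⟨x, hx, rfl⟩
    exact mul_mem (s := Y.Lg) (mul_mem (star_mem hw) (hθL.le ⟨x, hx, rfl⟩)) hw
  · intro hy
    obtain ⟨x, hx, hxy⟩ := hθL.ge
      (mul_mem (s := Y.Lg) (mul_mem hw hy) (star_mem hw))
    refine ⟨x, hx, ?_⟩
    change star w * θ.Θ x * w = y
    rw [hxy]
    calc star w * (w * y * star w) * w = (star w * w) * y * (star w * w) := by noncomm_ring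
      _ = y := by rw [hw1, one_mul, mul_one]

end Part3

end CD

open CD in
/-- Proposition `basicconstr1`. Let `Γ, Λ` be icc groups with
transitive trace-preserving actions on abelian von Neumann algebras `A, B` such that
`A ⋊ Γ` and `B ⋊ Λ` are II₁ factors, and let `θ : A ⋊ Γ → B ⋊ Λ` be a
`*`-isomorphism with `θ(L(Γ)) = L(Λ)`. Then `dim A = dim B` (the numbers of atoms
agree); for all atoms `a ∈ At(A)`, `b ∈ At(B)` there is a unitary `w ∈ L(Λ)` with
`θ(L(Stab_Γ(a))) = w* L(Stab_Λ(b)) w`; and if some `Stab_Γ(a)` is normal in `Γ` then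
every `Stab_Λ(b)` is normal in `Λ`, with `Γ/Stab_Γ(a) ≅ Λ/Stab_Λ(b)` (expressed by a
common quotient group). -/
theorem stmt6_transitive_actions_and_stabilizers
    (Γ : Type) [Group Γ] [Countable Γ] (hiccΓ : IsICC Γ)
    (Λ : Type) [Group Λ] [Countable Λ] (hiccΛ : IsICC Λ)
    (H₁ : Type) [NormedAddCommGroup H₁] [InnerProductSpace ℂ H₁] [CompleteSpace H₁]
    (H₂ : Type) [NormedAddCommGroup H₂] [InnerProductSpace ℂ H₂] [CompleteSpace H₂]
    (X : CrossedProduct Γ H₁) (Y : CrossedProduct Λ H₂)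
    (habelA : IsAbelianSet (X.A : Set (H₁ →L[ℂ] H₁)))
    (habelB : IsAbelianSet (Y.A : Set (H₂ →L[ℂ] H₂)))
    -- `A ⋊ Γ` and `B ⋊ Λ` are II₁ factors
    (hfacX : IsII1On X.tr (X.M : Set (H₁ →L[ℂ] H₁)))
    (hfacY : IsII1On Y.tr (Y.M : Set (H₂ →L[ℂ] H₂)))
    -- the actions are transitive, with atoms `eA : Fin nA`, `eB : Fin nB`
    (nA : ℕ) (eA : Fin nA → (H₁ →L[ℂ] H₁))
    (heAproj : ∀ i, eA i ∈ X.A ∧ star (eA i) = eA i ∧ eA i * eA i = eA i ∧ eA i ≠ 0)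
    (heAorth : ∀ i j, i ≠ j → eA i * eA j = 0) (heAsum : ∑ i, eA i = 1)
    (heAspan : ∀ a ∈ X.A, ∃ c : Fin nA → ℂ, a = ∑ i, c i • eA i)
    (heAtrans : ∀ i j, ∃ γ : Γ, X.σ γ (eA i) = eA j)
    (nB : ℕ) (eB : Fin nB → (H₂ →L[ℂ] H₂))
    (heBproj : ∀ i, eB i ∈ Y.A ∧ star (eB i) = eB i ∧ eB i * eB i = eB i ∧ eB i ≠ 0)
    (heBorth : ∀ i j, i ≠ j → eB i * eB j = 0) (heBsum : ∑ i, eB i = 1)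
    (heBspan : ∀ b ∈ Y.A, ∃ c : Fin nB → ℂ, b = ∑ i, c i • eB i)
    (heBtrans : ∀ i j, ∃ lam : Λ, Y.σ lam (eB i) = eB j)
    -- a `*`-isomorphism `θ : A ⋊ Γ → B ⋊ Λ` with `θ(L(Γ)) = L(Λ)`
    (θ : StarIsoOn (X.M : Set (H₁ →L[ℂ] H₁)) (Y.M : Set (H₂ →L[ℂ] H₂)))
    (hθL : θ.Θ '' (X.Lg : Set (H₁ →L[ℂ] H₁)) = (Y.Lg : Set (H₂ →L[ℂ] H₂))) :
    -- `dim(A) = dim(B)`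
    nA = nB ∧
    -- for every pair of atoms, `θ(L(Stab_Γ(a))) = w* L(Stab_Λ(b)) w` for some
    -- unitary `w ∈ L(Λ)`
    (∀ (i : Fin nA) (j : Fin nB), ∃ w, IsUnitaryIn (Y.Lg : Set (H₂ →L[ℂ] H₂)) w ∧
      θ.Θ '' LStabSet X (eA i) =
        (fun y => star w * y * w) '' LStabSet Y (eB j)) ∧
    -- if some `Stab_Γ(a)` is normal in `Γ`, then every `Stab_Λ(b)` is normal in `Λ`
    -- and `Γ/Stab_Γ(a) ≅ Λ/Stab_Λ(b)`
    (∀ i : Fin nA,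
      (∀ g γ : Γ, X.σ γ (eA i) = eA i → X.σ (g * γ * g⁻¹) (eA i) = eA i) →
      ∀ j : Fin nB,
        (∀ h lam : Λ, Y.σ lam (eB j) = eB j → Y.σ (h * lam * h⁻¹) (eB j) = eB j) ∧
        (∃ (G : Type) (_ : Group G) (φ : Γ →* G) (ψ : Λ →* G),
          Function.Surjective φ ∧ Function.Surjective ψ ∧
          (∀ γ : Γ, φ γ = 1 ↔ X.σ γ (eA i) = eA i) ∧
          (∀ lam : Λ, ψ lam = 1 ↔ Y.σ lam (eB j) = eB j))) := by
  have h : Atoms X nA eA := ⟨hiccΓ, hfacX.1, fun i => (heAproj i).1, fun i => (heAproj i).2.1,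
    fun i => (heAproj i).2.2.1, fun i => (heAproj i).2.2.2, heAorth, heAsum, heAspan, heAtrans⟩
  have h' : Atoms Y nB eB := ⟨hiccΛ, hfacY.1, fun i => (heBproj i).1, fun i => (heBproj i).2.1,
    fun i => (heBproj i).2.2.1, fun i => (heBproj i).2.2.2, heBorth, heBsum, heBspan, heBtrans⟩
  have hA : 0 < nA := by exact_mod_cast h.n_pos
  have hB : 0 < nB := by exact_mod_cast h'.n_pos
  have hn : nA = nB := (main_conj h h' θ hθL ⟨0, hA⟩ ⟨0, hB⟩).1
  refine ⟨hn, ?_, ?_⟩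
  · intro i j
    obtain ⟨-, w, hw, hθ⟩ := main_conj h h' θ hθL i j
    refine ⟨star w, ⟨star_mem (s := Y.Lg) hw.1, by rw [star_star]; exact hw.2.2,
      by rw [star_star]; exact hw.2.1⟩, ?_⟩
    rw [theta_LStab h h' θ hθL i j hw hθ, star_star]
  · intro i hnorm j
    subst hn
    obtain ⟨-, w, ⟨hw, hw1, hw2⟩, hθ⟩ := main_conj h h' θ hθL i j
    refine part3 h h' (θ.conj w (Y.Lg_M hw) hw1 hw2) (conj_Lg θ hθL hw hw1 hw2) i j ?_ hnorm
    change star w * θ.Θ (eA i) * w = eB j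
    rw [hθ]
    calc star w * (w * eB j * star w) * w = (star w * w) * eB j * (star w * w) := by noncomm_ring
      _ = eB j := by rw [hw1, one_mul, mul_one]
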